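/- arXiv:1510.07135 — 2 statements merged into one kernel-verified Lean document; each statement's English description precedes it below -/
import Mathlib

section
/- Let G be a 2-connected finite simple graph that does not contain K̂₄ as an induced minor and that contains a proper K₄-subdivision. Let W be a 3-wheel subgraph of G with the minimum number of vertices, let C be the cycle of W, and let R be the subgraph of G induced by V(G) \ V(C). Then R is a complete multipartite graph. -/
open SimpleGraph

namespace IMWQO

/-- `H` is an induced minor of `G`: there is a family of pairwise disjoint nonempty
connected subsets of `V(G)`, indexed by `V(H)`, such that distinct branch sets are
joined by an edge of `G` iff the corresponding vertices are adjacent in `H`. -/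
def IsInducedMinor {α β : Type*} (H : SimpleGraph α) (G : SimpleGraph β) : Prop :=
  ∃ μ : α → Set β,
    (∀ a, (μ a).Nonempty) ∧
    (∀ a b, a ≠ b → Disjoint (μ a) (μ b)) ∧
    (∀ a, (G.induce (μ a)).Connected) ∧
    (∀ a b, a ≠ b → ((∃ x ∈ μ a, ∃ y ∈ μ b, G.Adj x y) ↔ H.Adj a b))

/-- A bundled finite simple graph. -/
abbrev FinGraph := Σ n : ℕ, SimpleGraph (Fin n)

/-- The induced minor relation on bundled finite graphs. -/
def FinGraph.IM (H G : FinGraph) : Prop := IsInducedMinor H.2 G.2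

/-- A class of finite graphs is well-quasi-ordered by the induced minor relation. -/
def WqoClass (P : FinGraph → Prop) : Prop :=
  ∀ f : ℕ → FinGraph, (∀ i, P (f i)) → ∃ i j, i < j ∧ FinGraph.IM (f i) (f j)

/-- `K̂₄`: `K₄` (on vertices `0,1,2,3`) plus a vertex `4` adjacent to `0` and `1`. -/
def hatK4 : SimpleGraph (Fin 5) :=
  SimpleGraph.fromRel fun a b =>
    (a.val < 4 ∧ b.val < 4) ∨ (a.val = 4 ∧ (b.val = 0 ∨ b.val = 1))

/-- The gem: the path `0 - 1 - 2 - 3` plus a dominating vertex `4`. -/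
def gem : SimpleGraph (Fin 5) :=
  SimpleGraph.fromRel fun a b =>
    (b.val = a.val + 1 ∧ b.val ≤ 3) ∨ a.val = 4

/-- The complete graph on four vertices. -/
def K4 : SimpleGraph (Fin 4) := ⊤

/-- The prism, i.e. the Cartesian (box) product `K₃ □ K₂`. -/
def prism : SimpleGraph (Fin 3 × Fin 2) :=
  (⊤ : SimpleGraph (Fin 3)) □ (⊤ : SimpleGraph (Fin 2))

/-- The complete bipartite graph `K_{3,3}`. -/
def K33 : SimpleGraph (Fin 3 ⊕ Fin 3) := completeBipartiteGraph (Fin 3) (Fin 3)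

/-- Subdivide the edge `{u,v}` of `G`, the new vertex being `Fin.last n`. -/
def subdivideEdge {n : ℕ} (G : SimpleGraph (Fin n)) (u v : Fin n) :
    SimpleGraph (Fin (n + 1)) :=
  SimpleGraph.fromRel fun a b =>
    (∃ a' b' : Fin n, a = a'.castSucc ∧ b = b'.castSucc ∧ G.Adj a' b' ∧
      ¬(a' = u ∧ b' = v) ∧ ¬(a' = v ∧ b' = u))
    ∨ (a = Fin.last n ∧ (b = u.castSucc ∨ b = v.castSucc))

/-- One subdivision step on bundled graphs: the first graph is obtained from the
second one by subdividing one edge. -/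
inductive SubdivStep : FinGraph → FinGraph → Prop
  | mk {n : ℕ} (G : SimpleGraph (Fin n)) (u v : Fin n) (h : G.Adj u v) :
      SubdivStep ⟨n + 1, subdivideEdge G u v⟩ ⟨n, G⟩

/-- `G` is (isomorphic to) a subdivision of `H`. -/
def IsSubdivision {α β : Type*} (G : SimpleGraph α) (H : SimpleGraph β) : Prop :=
  ∃ A B : FinGraph, Nonempty (G ≃g A.2) ∧ Nonempty (H ≃g B.2) ∧
    Relation.ReflTransGen SubdivStep A B

/-- `G` contains a subdivision of `H` as a subgraph. -/
def ContainsSubdivAsSubgraph {α β : Type*} (G : SimpleGraph α) (H : SimpleGraph β) : Prop :=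
  ∃ S : G.Subgraph, IsSubdivision S.coe H

/-- `G` has a proper `K₄`-subdivision: for some vertex `v`, `G - v` contains
a subdivision of `K₄` as a subgraph. -/
def HasProperK4Subdivision {α : Type*} (G : SimpleGraph α) : Prop :=
  ∃ v : α, ContainsSubdivAsSubgraph (G.induce {u | u ≠ v}) K4

/-- `G` is 2-connected: at least 3 vertices, and removing any vertex leaves it connected. -/
def TwoConnected {α : Type*} [Fintype α] (G : SimpleGraph α) : Prop :=
  3 ≤ Fintype.card α ∧ ∀ v : α, (G.induce {u | u ≠ v}).Connected

/-- `G` is complete multipartite: two vertices are adjacent iff they lie in different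
classes of some partition (equivalence relation). -/
def IsCompleteMultipartite {α : Type*} (G : SimpleGraph α) : Prop :=
  ∃ s : Setoid α, ∀ u v, G.Adj u v ↔ ¬ s.r u v

/-- `G` is a cograph: it has no induced path on four vertices. -/
def IsCograph {α : Type*} (G : SimpleGraph α) : Prop :=
  ∀ f : Fin 4 → α, Function.Injective f →
    ¬ (∀ a b : Fin 4, G.Adj (f a) (f b) ↔ (pathGraph 4).Adj a b)

/-- `G` is a linear forest: acyclic with maximum degree at most 2,
i.e. a disjoint union of paths. -/
def IsLinearForest {α : Type*} (G : SimpleGraph α) : Prop :=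
  G.IsAcyclic ∧ ∀ v, (G.neighborSet v).ncard ≤ 2

/-- The set `C` induces an (induced) cycle in `G`. -/
def InducesCycle {α : Type*} (G : SimpleGraph α) (C : Set α) : Prop :=
  ∃ n : ℕ, 3 ≤ n ∧ Nonempty ((G.induce C) ≃g cycleGraph n)

/-- The set `S` induces a path in `G` all of whose internal vertices have degree two
in `G`. -/
def IsBasicPath {α : Type*} (G : SimpleGraph α) (S : Set α) : Prop :=
  ∃ (n : ℕ) (φ : (G.induce S) ≃g pathGraph n),
    ∀ v : S, (φ v).val ≠ 0 → (φ v).val ≠ n - 1 → (G.neighborSet v.val).ncard = 2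

/-- The wheel with cycle `0, …, n-1` and center adjacent to the vertices of `T`. -/
def wheelGraph (n : ℕ) (T : Finset (Fin n)) : SimpleGraph (Fin n ⊕ Unit) :=
  SimpleGraph.fromRel fun a b =>
    (∃ x y : Fin n, a = Sum.inl x ∧ b = Sum.inl y ∧ (cycleGraph n).Adj x y)
    ∨ (∃ x ∈ T, a = Sum.inr () ∧ b = Sum.inl x)

/-- `G` is a `k`-wheel: a cycle of order at least `max k 3` plus a center adjacent to
exactly `k` distinct vertices of the cycle. -/
def IsWheel {α : Type*} (k : ℕ) (G : SimpleGraph α) : Prop :=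
  ∃ n : ℕ, 3 ≤ n ∧ k ≤ n ∧ ∃ T : Finset (Fin n), T.card = k ∧
    Nonempty (G ≃g wheelGraph n T)

/-- A 3-wheel subgraph of `G`: a cycle of `G` together with a center outside the cycle
joined to (at least) three distinct vertices of the cycle by edges of `G`. -/
structure ThreeWheelSub {α : Type*} (G : SimpleGraph α) where
  base : α
  cyc : G.Walk base base
  cyc_isCycle : cyc.IsCycle
  center : α
  center_not_mem : center ∉ cyc.support
  spokes : Finset α
  spokes_card : spokes.card = 3
  spokes_sub : ∀ x ∈ spokes, x ∈ cyc.support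
  spokes_adj : ∀ x ∈ spokes, G.Adj center x

/-- The number of vertices of a 3-wheel subgraph. -/
def ThreeWheelSub.order {α : Type*} [DecidableEq α] {G : SimpleGraph α}
    (W : ThreeWheelSub G) : ℕ :=
  W.cyc.support.toFinset.card + 1

/-- `G` has a cycle-multipartite decomposition. -/
def HasCycleMultipartiteDecomp {α : Type*} (G : SimpleGraph α) : Prop :=
  ∃ C R : Set α, C ∪ R = Set.univ ∧ Disjoint C R ∧
    InducesCycle G C ∧ IsCompleteMultipartite (G.induce R) ∧
    ∀ u ∈ R, ∀ v ∈ R, ∀ c ∈ C, (G.Adj u c ↔ G.Adj v c)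

/-- A bundled finite simple graph whose vertices are labeled by finite subsets of `S`. -/
structure LabGraph (S : Type*) where
  n : ℕ
  graph : SimpleGraph (Fin n)
  label : Fin n → Finset S

/-- The domination order on finite subsets of a quasi-order: `A ≤^P B` iff there is an
injection `φ : A → B` with `r a (φ a)` for all `a ∈ A`. -/
def FinsetLE {S : Type*} (r : S → S → Prop) (A B : Finset S) : Prop :=
  ∃ φ : {x // x ∈ A} → {x // x ∈ B}, Function.Injective φ ∧ ∀ a, r a.val (φ a).val

/-- The union of the labels of the vertices in `A`. -/
noncomputable def labelUnion {S : Type*} {n : ℕ} (lab : Fin n → Finset S)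
    (A : Finset (Fin n)) : Finset S :=
  letI := Classical.decEq S
  A.biUnion lab

/-- Label-respecting induced minor relation on labeled graphs. -/
def LabIM {S : Type*} (r : S → S → Prop) (H G : LabGraph S) : Prop :=
  ∃ μ : Fin H.n → Finset (Fin G.n),
    (∀ a, (μ a).Nonempty) ∧
    (∀ a b, a ≠ b → Disjoint (μ a) (μ b)) ∧
    (∀ a, (G.graph.induce (↑(μ a) : Set (Fin G.n))).Connected) ∧
    (∀ a b, a ≠ b → ((∃ x ∈ μ a, ∃ y ∈ μ b, G.graph.Adj x y) ↔ H.graph.Adj a b)) ∧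
    (∀ a, FinsetLE r (H.label a) (labelUnion G.label (μ a)))

/-- Label-respecting contraction relation on labeled graphs: an induced minor model
whose branch sets cover all vertices. -/
def LabContraction {S : Type*} (r : S → S → Prop) (H G : LabGraph S) : Prop :=
  ∃ μ : Fin H.n → Finset (Fin G.n),
    (∀ a, (μ a).Nonempty) ∧
    (∀ a b, a ≠ b → Disjoint (μ a) (μ b)) ∧
    (∀ x : Fin G.n, ∃ a, x ∈ μ a) ∧
    (∀ a, (G.graph.induce (↑(μ a) : Set (Fin G.n))).Connected) ∧
    (∀ a b, a ≠ b → ((∃ x ∈ μ a, ∃ y ∈ μ b, G.graph.Adj x y) ↔ H.graph.Adj a b)) ∧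
    (∀ a, FinsetLE r (H.label a) (labelUnion G.label (μ a)))

/-- Label-respecting induced subgraph relation on labeled graphs. -/
def LabISub {S : Type*} (r : S → S → Prop) (H G : LabGraph S) : Prop :=
  ∃ φ : Fin H.n → Fin G.n, Function.Injective φ ∧
    (∀ a b, H.graph.Adj a b ↔ G.graph.Adj (φ a) (φ b)) ∧
    (∀ a, FinsetLE r (H.label a) (G.label (φ a)))

/-- A relation is a well-quasi-order: every infinite sequence contains a good pair. -/
def IsWqo {S : Type*} (r : S → S → Prop) : Prop :=
  ∀ g : ℕ → S, ∃ i j, i < j ∧ r (g i) (g j)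


section K4Models

variable {α : Type*} {G : SimpleGraph α}

/-- Some edge of `G` joins `A` to `B`. -/
def Touch (G : SimpleGraph α) (A B : Set α) : Prop :=
  ∃ x ∈ A, ∃ y ∈ B, G.Adj x y

lemma Touch.symm {A B : Set α} (h : Touch G A B) : Touch G B A := by
  obtain ⟨x, hx, y, hy, hxy⟩ := h
  exact ⟨y, hy, x, hx, hxy.symm⟩

lemma Touch.mono {A A' B B' : Set α} (h : Touch G A B) (hA : A ⊆ A') (hB : B ⊆ B') :
    Touch G A' B' := by
  obtain ⟨x, hx, y, hy, hxy⟩ := h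
  exact ⟨x, hA hx, y, hB hy, hxy⟩

lemma induce_singleton_connected (x : α) : (G.induce {x}).Connected := by
  have : Nonempty ({x} : Set α) := ⟨⟨x, rfl⟩⟩
  exact ⟨Preconnected.of_subsingleton⟩

lemma induce_union_connected_of_touch {A B : Set α} (hA : (G.induce A).Connected)
    (hB : (G.induce B).Connected) (h : Touch G A B) : (G.induce (A ∪ B)).Connected := by
  obtain ⟨x, hx, y, hy, hxy⟩ := h
  exact connected_induce_union hA.preconnected hB.preconnected hx hy hxy

/-- The sets `P 0, …, P 3` form a minor model of `K₄` in `G`. -/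
structure IsK4Model (G : SimpleGraph α) (P : Fin 4 → Set α) : Prop where
  connected : ∀ i, (G.induce (P i)).Connected
  disjoint : ∀ i j, i ≠ j → Disjoint (P i) (P j)
  touch : ∀ i j, i ≠ j → Touch G (P i) (P j)

lemma IsK4Model.of_sets {A B C D : Set α}
    (hA : (G.induce A).Connected) (hB : (G.induce B).Connected)
    (hC : (G.induce C).Connected) (hD : (G.induce D).Connected)
    (dAB : Disjoint A B) (dAC : Disjoint A C) (dAD : Disjoint A D)
    (dBC : Disjoint B C) (dBD : Disjoint B D) (dCD : Disjoint C D)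
    (tAB : Touch G A B) (tAC : Touch G A C) (tAD : Touch G A D)
    (tBC : Touch G B C) (tBD : Touch G B D) (tCD : Touch G C D) :
    IsK4Model G ![A, B, C, D] where
  connected i := by fin_cases i <;> assumption
  disjoint i j hij := by
    fin_cases i <;> fin_cases j <;>
      first | exact absurd rfl hij | assumption | (apply Disjoint.symm; assumption)
  touch i j hij := by
    fin_cases i <;> fin_cases j <;>
      first | exact absurd rfl hij | assumption | (apply Touch.symm; assumption)

/-- A connected set may be merged into the only branch set that it meets. -/
lemma IsK4Model.attach {P : Fin 4 → Set α} (h : IsK4Model G P) {S : Set α} {i : Fin 4}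
    (hS : (G.induce S).Connected) (hi : (P i ∩ S).Nonempty)
    (hd : ∀ k, k ≠ i → Disjoint (P k) S) :
    IsK4Model G (Function.update P i (P i ∪ S)) where
  connected k := by
    rcases eq_or_ne k i with rfl | hk
    · rw [Function.update_self]
      exact induce_union_connected (h.connected k).preconnected hS.preconnected hi
    · rw [Function.update_of_ne hk]
      exact h.connected k
  disjoint k l hkl := by
    rcases eq_or_ne k i with rfl | hk <;> rcases eq_or_ne l k with rfl | hl
    · exact absurd rfl hkl
    · simpa [hl] using ⟨h.disjoint _ _ hkl, (hd l hl).symm⟩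
    · exact absurd rfl hkl
    · rcases eq_or_ne l i with rfl | hl'
      · simpa [hk] using ⟨h.disjoint _ _ hkl, hd k hk⟩
      · simpa [hk, hl'] using h.disjoint _ _ hkl
  touch k l hkl := by
    have key : ∀ m, P m ⊆ Function.update P i (P i ∪ S) m := by
      intro m
      rcases eq_or_ne m i with rfl | hm
      · simp
      · simp [hm]
    exact (h.touch k l hkl).mono (key k) (key l)

/-- A connected set touching exactly two branch sets of a `K₄` model yields `K̂₄`. -/
theorem IsK4Model.isInducedMinor_hatK4 {P : Fin 4 → Set α} (h : IsK4Model G P) {E : Set α}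
    (hE : (G.induce E).Connected) (hd : ∀ k, Disjoint (P k) E) {i j : Fin 4} (hij : i ≠ j)
    (ht : ∀ k, Touch G E (P k) ↔ k = i ∨ k = j) : IsInducedMinor hatK4 G := by
  obtain ⟨σ, hσ0, hσ1⟩ : ∃ σ : Equiv.Perm (Fin 4), σ 0 = i ∧ σ 1 = j := by
    clear ht
    revert i j
    decide
  have hlast : ∀ k : Fin 4, hatK4.Adj (Fin.last 4) k.castSucc ↔ k = 0 ∨ k = 1 := by
    intro k
    fin_cases k <;> simp [hatK4, SimpleGraph.fromRel_adj]
  have hcast : ∀ k l : Fin 4, hatK4.Adj k.castSucc l.castSucc ↔ k ≠ l := by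
    intro k l
    simp [hatK4, SimpleGraph.fromRel_adj]
  have hE' : ∀ k, Touch G E (P (σ k)) ↔ k = 0 ∨ k = 1 := by
    intro k
    rw [ht, ← hσ0, ← hσ1, σ.injective.eq_iff, σ.injective.eq_iff]
  refine ⟨Fin.snoc (α := fun _ => Set α) (fun k => P (σ k)) E, ?_, ?_, ?_, ?_⟩
  · intro a
    induction a using Fin.lastCases with
    | last => rw [Fin.snoc_last]; exact Set.nonempty_coe_sort.1 hE.nonempty
    | cast k => rw [Fin.snoc_castSucc]; exact Set.nonempty_coe_sort.1 (h.connected (σ k)).nonempty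
  · intro a b hab
    induction a using Fin.lastCases with
    | last =>
      induction b using Fin.lastCases with
      | last => exact absurd rfl hab
      | cast l => rw [Fin.snoc_last, Fin.snoc_castSucc]; exact (hd (σ l)).symm
    | cast k =>
      induction b using Fin.lastCases with
      | last => rw [Fin.snoc_last, Fin.snoc_castSucc]; exact hd (σ k)
      | cast l =>
        rw [Fin.snoc_castSucc, Fin.snoc_castSucc]
        exact h.disjoint _ _ (σ.injective.ne fun hkl => hab (congrArg _ hkl))
  · intro a
    induction a using Fin.lastCases with
    | last => rw [Fin.snoc_last]; exact hE
    | cast k => rw [Fin.snoc_castSucc]; exact h.connected (σ k)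
  · intro a b hab
    induction a using Fin.lastCases with
    | last =>
      induction b using Fin.lastCases with
      | last => exact absurd rfl hab
      | cast l =>
        rw [Fin.snoc_last, Fin.snoc_castSucc, hlast]
        exact hE' l
    | cast k =>
      induction b using Fin.lastCases with
      | last =>
        rw [Fin.snoc_last, Fin.snoc_castSucc, SimpleGraph.adj_comm, hlast]
        exact Iff.trans ⟨Touch.symm, Touch.symm⟩ (hE' k)
      | cast l =>
        have hkl : k ≠ l := fun hkl => hab (congrArg _ hkl)
        rw [Fin.snoc_castSucc, Fin.snoc_castSucc, hcast]
        exact iff_of_true (h.touch _ _ (σ.injective.ne hkl)) hkl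

end K4Models

section Cycles

variable {α : Type*} {G : SimpleGraph α} {n : ℕ} {c : ℕ → α}

/-- The vertex `x` has at least three neighbours in `S`. -/
def HasThreeNbrs (G : SimpleGraph α) (S : Set α) (x : α) : Prop :=
  ∃ p ∈ S, ∃ q ∈ S, ∃ r ∈ S, p ≠ q ∧ p ≠ r ∧ q ≠ r ∧ G.Adj x p ∧ G.Adj x q ∧ G.Adj x r

/-- `c` runs periodically around a cycle of length `n` in `G`. -/
structure IsCyclicParam (G : SimpleGraph α) (n : ℕ) (c : ℕ → α) : Prop where
  pos : 0 < n
  adj : ∀ i, G.Adj (c i) (c (i + 1))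
  eq_iff : ∀ i j, c i = c j ↔ i ≡ j [MOD n]

lemma exists_isCyclicParam {u : α} {p : G.Walk u u} (hp : p.IsCycle) :
    ∃ n c, IsCyclicParam G n c ∧ Set.range c = {v | v ∈ p.support} := by
  have hlen := hp.three_le_length
  have hwrap : p.getVert p.length = p.getVert 0 := by simp
  refine ⟨p.length, fun i => p.getVert (i % p.length), ⟨by omega, fun i => ?_, fun i j => ?_⟩, ?_⟩
  · have hlt := Nat.mod_lt i (show 0 < p.length by omega)
    have hadj := p.adj_getVert_succ hlt
    have hmod : (i + 1) % p.length = (i % p.length + 1) % p.length := by simp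
    rw [hmod]
    rcases Nat.lt_or_ge (i % p.length + 1) p.length with h | h
    · rwa [Nat.mod_eq_of_lt h]
    · have h' : i % p.length + 1 = p.length := by omega
      rw [h', hwrap] at hadj
      rwa [h', Nat.mod_self]
  · refine ⟨fun h => ?_, fun h => congrArg p.getVert h⟩
    have hi := Nat.mod_lt i (show 0 < p.length by omega)
    have hj := Nat.mod_lt j (show 0 < p.length by omega)
    exact hp.getVert_injOn' (by simp only [Set.mem_ofPred_eq]; omega)
      (by simp only [Set.mem_ofPred_eq]; omega) h
  · ext v
    simp only [Set.mem_range, Set.mem_ofPred_eq, Walk.mem_support_iff_exists_getVert]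
    constructor
    · rintro ⟨i, rfl⟩
      exact ⟨_, rfl, (Nat.mod_lt i (by omega)).le⟩
    · rintro ⟨i, rfl, hi⟩
      rcases hi.eq_or_lt with rfl | hi
      · exact ⟨0, by simp⟩
      · exact ⟨i, by rw [Nat.mod_eq_of_lt hi]⟩

namespace IsCyclicParam

lemma add_period (hc : IsCyclicParam G n c) (i : ℕ) : c (i + n) = c i :=
  (hc.eq_iff _ _).2 (by simp [Nat.ModEq])

lemma exists_mem_window (hc : IsCyclicParam G n c) (i : ℕ) {v : α} (hv : v ∈ Set.range c) :
    ∃ m, i ≤ m ∧ m < i + n ∧ c m = v := by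
  obtain ⟨k, rfl⟩ := hv
  have hn := hc.pos
  refine ⟨i + (k + (n - i % n)) % n, by omega, ?_, ?_⟩
  · have := Nat.mod_lt (k + (n - i % n)) hn
    omega
  · rw [hc.eq_iff]
    have h1 : i + (k + (n - i % n)) % n ≡ i + (k + (n - i % n)) [MOD n] :=
      (Nat.mod_modEq _ _).add_left _
    have h2 : i + (k + (n - i % n)) = k + n * (i / n + 1) := by
      have := Nat.mod_lt i hn
      have h3 := Nat.div_add_mod i n
      rw [Nat.mul_add, Nat.mul_one]
      omega
    rw [h2] at h1
    exact h1.trans (by simp [Nat.ModEq])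

lemma injOn_window (hc : IsCyclicParam G n c) {i j k : ℕ} (hij : i ≤ j) (hjk : j < k)
    (hk : k < i + n) : c j ≠ c k := by
  intro h
  have h' := (hc.eq_iff j k).1 h
  have hdvd := (Nat.modEq_iff_dvd' hjk.le).1 h'
  have := Nat.le_of_dvd (by omega) hdvd
  omega

lemma disjoint_arcs (hc : IsCyclicParam G n c) {i j k l : ℕ} (hjk : j ≤ k)
    (hl : l ≤ i + n) : Disjoint (c '' Set.Ico i j) (c '' Set.Ico k l) := by
  rw [Set.disjoint_left]
  rintro _ ⟨a, ⟨ha1, ha2⟩, rfl⟩ ⟨b, ⟨hb1, hb2⟩, hab⟩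
  exact hc.injOn_window ha1 (by omega) (by omega) hab.symm

lemma connected_arc (hc : IsCyclicParam G n c) {i j : ℕ} (hij : i < j) :
    (G.induce (c '' Set.Ico i j)).Connected := by
  obtain ⟨k, rfl⟩ : ∃ k, j = i + 1 + k := ⟨j - (i + 1), by omega⟩
  clear hij
  induction k with
  | zero =>
    have h : Set.Ico i (i + 1 + 0) = {i} := by
      ext m
      simp only [Set.mem_Ico, Set.mem_singleton_iff]
      omega
    rw [h, Set.image_singleton]
    exact induce_singleton_connected _
  | succ k ih =>
    have h : Set.Ico i (i + 1 + (k + 1)) = Set.Ico i (i + 1 + k) ∪ {i + 1 + k} := by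
      ext m
      simp only [Set.mem_Ico, Set.mem_singleton_iff, Set.mem_union]
      omega
    rw [h, Set.image_union, Set.image_singleton]
    refine induce_union_connected_of_touch ih (induce_singleton_connected _)
      ⟨c (i + k), ⟨i + k, ⟨by omega, by omega⟩, rfl⟩, _, rfl, ?_⟩
    have := hc.adj (i + k)
    rwa [show i + k + 1 = i + 1 + k by omega] at this

lemma touch_arcs (hc : IsCyclicParam G n c) {i j k : ℕ} (hij : i < j) (hjk : j < k) :
    Touch G (c '' Set.Ico i j) (c '' Set.Ico j k) := by
  refine ⟨c (j - 1), ⟨j - 1, ⟨by omega, by omega⟩, rfl⟩, c j, ⟨j, ⟨le_rfl, hjk⟩, rfl⟩, ?_⟩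
  have := hc.adj (j - 1)
  rwa [show j - 1 + 1 = j by omega] at this

lemma touch_arcs_wrap (hc : IsCyclicParam G n c) {i j k : ℕ} (hij : i < j) (hk : k < i + n) :
    Touch G (c '' Set.Ico i j) (c '' Set.Ico k (i + n)) := by
  refine ⟨c i, ⟨i, ⟨le_rfl, hij⟩, rfl⟩, c (i + n - 1), ⟨i + n - 1, ⟨by omega, by omega⟩, rfl⟩, ?_⟩
  have := hc.adj (i + n - 1)
  rw [show i + n - 1 + 1 = i + n by omega, hc.add_period] at this
  exact this.symm

lemma disjoint_singleton_arc {x : α} (hx : x ∉ Set.range c) (i j : ℕ) :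
    Disjoint {x} (c '' Set.Ico i j) := by
  rw [Set.disjoint_singleton_left]
  rintro ⟨m, -, rfl⟩
  exact hx ⟨m, rfl⟩

lemma isK4Model_three_arcs (hc : IsCyclicParam G n c) {x : α} (hx : x ∉ Set.range c)
    {i j k a b d : ℕ} (ha : i ≤ a ∧ a < j) (hb : j ≤ b ∧ b < k) (hd : k ≤ d ∧ d < i + n)
    (hxa : G.Adj x (c a)) (hxb : G.Adj x (c b)) (hxd : G.Adj x (c d)) :
    IsK4Model G ![{x}, c '' Set.Ico i j, c '' Set.Ico j k, c '' Set.Ico k (i + n)] :=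
  IsK4Model.of_sets (induce_singleton_connected x) (hc.connected_arc (by omega))
    (hc.connected_arc (by omega)) (hc.connected_arc (by omega))
    (disjoint_singleton_arc hx _ _) (disjoint_singleton_arc hx _ _)
    (disjoint_singleton_arc hx _ _)
    (hc.disjoint_arcs le_rfl (by omega)) (hc.disjoint_arcs (by omega) le_rfl)
    (hc.disjoint_arcs le_rfl (by omega))
    ⟨x, rfl, _, ⟨a, ha, rfl⟩, hxa⟩ ⟨x, rfl, _, ⟨b, hb, rfl⟩, hxb⟩ ⟨x, rfl, _, ⟨d, hd, rfl⟩, hxd⟩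
    (hc.touch_arcs (by omega) (by omega)) (hc.touch_arcs_wrap (by omega) (by omega))
    (hc.touch_arcs (by omega) (by omega))

lemma exists_ordered_nbrs (hc : IsCyclicParam G n c) {x : α}
    (h3 : HasThreeNbrs G (Set.range c) x) (i : ℕ) :
    ∃ a b d, i ≤ a ∧ a < b ∧ b < d ∧ d < i + n ∧
      G.Adj x (c a) ∧ G.Adj x (c b) ∧ G.Adj x (c d) := by
  obtain ⟨p, hp, q, hq, r, hr, hpq, hpr, hqr, hxp, hxq, hxr⟩ := h3
  obtain ⟨p, hp1, hp2, rfl⟩ := hc.exists_mem_window i hp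
  obtain ⟨q, hq1, hq2, rfl⟩ := hc.exists_mem_window i hq
  obtain ⟨r, hr1, hr2, rfl⟩ := hc.exists_mem_window i hr
  have hpq' : p ≠ q := fun h => hpq (congrArg c h)
  have hpr' : p ≠ r := fun h => hpr (congrArg c h)
  have hqr' : q ≠ r := fun h => hqr (congrArg c h)
  rcases hpq'.lt_or_gt with h1 | h1 <;> rcases hpr'.lt_or_gt with h2 | h2 <;>
    rcases hqr'.lt_or_gt with h3 | h3
  · exact ⟨p, q, r, hp1, h1, h3, hr2, hxp, hxq, hxr⟩
  · exact ⟨p, r, q, hp1, h2, h3, hq2, hxp, hxr, hxq⟩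
  · omega
  · exact ⟨r, p, q, hr1, h2, h1, hq2, hxr, hxp, hxq⟩
  · exact ⟨q, p, r, hq1, h1, h2, hr2, hxq, hxp, hxr⟩
  · omega
  · exact ⟨q, r, p, hq1, h3, h2, hp2, hxq, hxr, hxp⟩
  · exact ⟨r, q, p, hr1, h3, h1, hp2, hxr, hxq, hxp⟩

/-- Two vertices of a wheel with center `x` lie in distinct branch sets of some `K₄` model
living inside the wheel. -/
lemma exists_isK4Model_separating (hc : IsCyclicParam G n c) {x : α} (hx : x ∉ Set.range c)
    (h3 : HasThreeNbrs G (Set.range c) x) {s t : α} (hs : s ∈ insert x (Set.range c))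
    (ht : t ∈ insert x (Set.range c)) (hst : s ≠ t) :
    ∃ P, IsK4Model G P ∧ (∀ k, P k ⊆ insert x (Set.range c)) ∧
      ∃ i j, i ≠ j ∧ s ∈ P i ∧ t ∈ P j := by
  have hsub : ∀ i j k l m o : ℕ, ∀ r,
      (![{x}, c '' Set.Ico i j, c '' Set.Ico k l, c '' Set.Ico m o] : Fin 4 → Set α) r ⊆
        insert x (Set.range c) := by
    intro i j k l m o r
    fin_cases r
    · exact Set.singleton_subset_iff.2 (Set.mem_insert _ _)
    all_goals exact (Set.image_subset_range _ _).trans (Set.subset_insert _ _)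
  have hcenter : ∀ v ∈ Set.range c, ∃ P, IsK4Model G P ∧
      (∀ k, P k ⊆ insert x (Set.range c)) ∧ ∃ i j, i ≠ j ∧ x ∈ P i ∧ v ∈ P j := by
    intro v hv
    obtain ⟨a, b, d, -, hab, hbd, hd, hxa, hxb, hxd⟩ := hc.exists_ordered_nbrs h3 0
    obtain ⟨m, hm1, hm2, rfl⟩ := hc.exists_mem_window a hv
    refine ⟨_, hc.isK4Model_three_arcs hx ⟨le_rfl, hab⟩ ⟨le_rfl, hbd⟩ ⟨le_rfl, by omega⟩
      hxa hxb hxd, hsub _ _ _ _ _ _, 0, ?_⟩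
    rcases lt_or_ge m b with h | h
    · exact ⟨1, by decide, rfl, m, ⟨hm1, h⟩, rfl⟩
    · rcases lt_or_ge m d with h' | h'
      · exact ⟨2, by decide, rfl, m, ⟨h, h'⟩, rfl⟩
      · exact ⟨3, by decide, rfl, m, ⟨h', hm2⟩, rfl⟩
  rcases hs with rfl | hs
  · exact hcenter t (ht.resolve_left hst.symm)
  rcases ht with rfl | ht
  · obtain ⟨P, hP, hPs, i, j, hij, hi, hj⟩ := hcenter s hs
    exact ⟨P, hP, hPs, j, i, hij.symm, hj, hi⟩
  obtain ⟨p, rfl⟩ := hs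
  obtain ⟨q, hq1, hq2, rfl⟩ := hc.exists_mem_window p ht
  have hpq : p < q := hq1.lt_of_ne fun h => hst (congrArg c h)
  obtain ⟨a, b, d, ha, hab, hbd, hd, hxa, hxb, hxd⟩ := hc.exists_ordered_nbrs h3 p
  rcases lt_or_ge a q with haq | haq
  · refine ⟨_, hc.isK4Model_three_arcs hx (j := min b q) (k := d) ⟨ha, by omega⟩
      ⟨by omega, hbd⟩ ⟨le_rfl, hd⟩ hxa hxb hxd, hsub _ _ _ _ _ _, 1, ?_⟩
    rcases lt_or_ge q d with h | h
    · exact ⟨2, by decide, ⟨p, ⟨le_rfl, by omega⟩, rfl⟩, q, ⟨by omega, h⟩, rfl⟩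
    · exact ⟨3, by decide, ⟨p, ⟨le_rfl, by omega⟩, rfl⟩, q, ⟨h, hq2⟩, rfl⟩
  · exact ⟨_, hc.isK4Model_three_arcs hx (i := q) (j := b) (k := d) ⟨haq, hab⟩
      ⟨le_rfl, hbd⟩ ⟨le_rfl, by omega⟩ hxa hxb hxd, hsub _ _ _ _ _ _, 3, 1, by decide,
      ⟨p + n, ⟨by omega, by omega⟩, hc.add_period p⟩, q, ⟨le_rfl, by omega⟩, rfl⟩

end IsCyclicParam

end Cycles

section Wheels

variable {α : Type*} {G : SimpleGraph α} {n : ℕ} {c : ℕ → α}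

namespace IsCyclicParam

/-- In a graph without `K̂₄`, no connected set outside a wheel sees exactly two of its vertices,
even if these two are first enlarged by connected sets `S` and `T`. -/
lemma false_of_touch_two (hfree : ¬ IsInducedMinor hatK4 G) (hc : IsCyclicParam G n c) {x : α}
    (hx : x ∉ Set.range c) (h3 : HasThreeNbrs G (Set.range c) x) {s t : α}
    (hs : s ∈ insert x (Set.range c)) (ht : t ∈ insert x (Set.range c)) (hst : s ≠ t)
    {E S T : Set α} (hE : (G.induce E).Connected) (hS : (G.induce S).Connected)
    (hT : (G.induce T).Connected) (hsS : s ∈ S) (htT : t ∈ T)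
    (hSs : ∀ z ∈ insert x (Set.range c), z ∈ S → z = s)
    (hTt : ∀ z ∈ insert x (Set.range c), z ∈ T → z = t)
    (dST : Disjoint S T) (dE : Disjoint (insert x (Set.range c)) E)
    (dSE : Disjoint S E) (dTE : Disjoint T E) (tS : Touch G E S) (tT : Touch G E T)
    (hE2 : ∀ y ∈ E, ∀ z ∈ insert x (Set.range c), G.Adj y z → z = s ∨ z = t) : False := by
  obtain ⟨P, hP, hPZ, i, j, hij, hsi, htj⟩ := hc.exists_isK4Model_separating hx h3 hs ht hst
  have hPS : ∀ k, k ≠ i → Disjoint (P k) S := by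
    intro k hk
    rw [Set.disjoint_left]
    intro z hz hzS
    obtain rfl := hSs z (hPZ k hz) hzS
    exact Set.disjoint_left.1 (hP.disjoint k i hk) hz hsi
  have hPT : ∀ k, k ≠ j → Disjoint (P k) T := by
    intro k hk
    rw [Set.disjoint_left]
    intro z hz hzT
    obtain rfl := hTt z (hPZ k hz) hzT
    exact Set.disjoint_left.1 (hP.disjoint k j hk) hz htj
  have hQ := hP.attach hS ⟨s, hsi, hsS⟩ hPS
  have hQj : Function.update P i (P i ∪ S) j = P j := Function.update_of_ne hij.symm _ _
  have hR := hQ.attach (i := j) hT (by rw [hQj]; exact ⟨t, htj, htT⟩) (by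
    intro k hk
    rcases eq_or_ne k i with rfl | hki
    · rw [Function.update_self]
      exact Disjoint.union_left (hPT k hk) dST
    · rw [Function.update_of_ne hki]
      exact hPT k hk)
  rw [hQj] at hR
  refine hfree (hR.isInducedMinor_hatK4 hE (i := i) (j := j) ?_ hij ?_)
  · intro k
    have hk : Disjoint (P k) E := dE.mono_left (hPZ k)
    rcases eq_or_ne k j with rfl | hkj
    · rw [Function.update_self]
      exact Disjoint.union_left hk dTE
    · rw [Function.update_of_ne hkj]
      rcases eq_or_ne k i with rfl | hki
      · rw [Function.update_self]
        exact Disjoint.union_left hk dSE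
      · rwa [Function.update_of_ne hki]
  · intro k
    rcases eq_or_ne k j with rfl | hkj
    · rw [Function.update_self]
      exact iff_of_true (tT.mono le_rfl Set.subset_union_right) (Or.inr rfl)
    · rw [Function.update_of_ne hkj]
      rcases eq_or_ne k i with rfl | hki
      · rw [Function.update_self]
        exact iff_of_true (tS.mono le_rfl Set.subset_union_right) (Or.inl rfl)
      · rw [Function.update_of_ne hki]
        refine iff_of_false ?_ (by simp [hkj, hki])
        rintro ⟨y, hy, z, hz, hyz⟩
        rcases hE2 y hy z (hPZ k hz) hyz with rfl | rfl
        · exact Set.disjoint_left.1 (hP.disjoint k i hki) hz hsi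
        · exact Set.disjoint_left.1 (hP.disjoint k j hkj) hz htj

lemma false_of_touch_two_vertices (hfree : ¬ IsInducedMinor hatK4 G) (hc : IsCyclicParam G n c)
    {x : α} (hx : x ∉ Set.range c) (h3 : HasThreeNbrs G (Set.range c) x) {s t : α}
    (hs : s ∈ insert x (Set.range c)) (ht : t ∈ insert x (Set.range c)) (hst : s ≠ t)
    {E : Set α} (hE : (G.induce E).Connected) (dE : ∀ y ∈ E, y ∉ insert x (Set.range c))
    (tS : ∃ y ∈ E, G.Adj y s) (tT : ∃ y ∈ E, G.Adj y t)
    (hE2 : ∀ y ∈ E, ∀ z ∈ insert x (Set.range c), G.Adj y z → z = s ∨ z = t) : False := by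
  obtain ⟨y, hy, hys⟩ := tS
  obtain ⟨y', hy', hyt⟩ := tT
  refine hc.false_of_touch_two hfree hx h3 hs ht hst hE (induce_singleton_connected s)
    (induce_singleton_connected t) rfl rfl (fun z _ hz => hz) (fun z _ hz => hz)
    (Set.disjoint_singleton.2 hst) (Set.disjoint_right.2 dE)
    (Set.disjoint_singleton_left.2 fun h => dE s h hs)
    (Set.disjoint_singleton_left.2 fun h => dE t h ht) ⟨y, hy, s, rfl, hys⟩
    ⟨y', hy', t, rfl, hyt⟩ hE2

/-- A walk outside a wheel, each of whose vertices sees at most one vertex of the wheel, sees at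
most one vertex of the wheel. -/
lemma eq_of_adj_walk (hfree : ¬ IsInducedMinor hatK4 G) (hc : IsCyclicParam G n c)
    {x : α} (hx : x ∉ Set.range c) (h3 : HasThreeNbrs G (Set.range c) x) {u v : α}
    (p : G.Walk u v) (hZ : ∀ w ∈ p.support, w ∉ insert x (Set.range c))
    (hone : ∀ w ∈ p.support, ∀ s ∈ insert x (Set.range c), ∀ t ∈ insert x (Set.range c),
      G.Adj w s → G.Adj w t → s = t) :
    ∀ a ∈ p.support, ∀ b ∈ p.support, ∀ s ∈ insert x (Set.range c),
      ∀ t ∈ insert x (Set.range c), G.Adj a s → G.Adj b t → s = t := by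
  induction p with
  | nil =>
    intro a ha b hb
    rw [Walk.support_nil, List.mem_singleton] at ha hb
    rw [ha, hb]
    exact hone _ (by simp)
  | @cons u w v h p ih =>
    have hsupp : ∀ y, y ∈ (Walk.cons h p).support ↔ y = u ∨ y ∈ p.support := by simp
    have ih' := ih (fun y hy => hZ y ((hsupp y).2 (Or.inr hy)))
      (fun y hy => hone y ((hsupp y).2 (Or.inr hy)))
    have hu := hone u ((hsupp u).2 (Or.inl rfl))
    have mixed : ∀ b ∈ p.support, ∀ s ∈ insert x (Set.range c),
        ∀ t ∈ insert x (Set.range c), G.Adj u s → G.Adj b t → s = t := by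
      intro b hb s hs t ht hus hbt
      by_contra hst
      refine hc.false_of_touch_two_vertices hfree hx h3 hs ht hst
        (Walk.connected_induce_support (Walk.cons h p)) hZ ⟨u, (hsupp u).2 (Or.inl rfl), hus⟩
        ⟨b, (hsupp b).2 (Or.inr hb), hbt⟩ ?_
      intro y hy z hz hyz
      rcases (hsupp y).1 hy with rfl | hy
      · exact Or.inl (hu z hz s hs hyz hus)
      · exact Or.inr (ih' y hy b hb z hz t ht hyz hbt)
    intro a ha b hb s hs t ht has hbt
    rcases (hsupp a).1 ha with rfl | ha' <;> rcases (hsupp b).1 hb with rfl | hb'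
    · exact hu s hs t ht has hbt
    · exact mixed b hb' s hs t ht has hbt
    · exact (mixed a ha' t ht s hs hbt has).symm
    · exact ih' a ha' b hb' s hs t ht has hbt

lemma hasThreeNbrs_of_two (hfree : ¬ IsInducedMinor hatK4 G) (hc : IsCyclicParam G n c)
    {x : α} (hx : x ∉ Set.range c) (h3 : HasThreeNbrs G (Set.range c) x) {y s t : α}
    (hy : y ∉ insert x (Set.range c)) (hs : s ∈ insert x (Set.range c))
    (ht : t ∈ insert x (Set.range c)) (hst : s ≠ t) (hys : G.Adj y s) (hyt : G.Adj y t) :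
    HasThreeNbrs G (insert x (Set.range c)) y := by
  by_contra hnot
  refine hc.false_of_touch_two_vertices hfree hx h3 hs ht hst (induce_singleton_connected y)
    (by rintro _ rfl; exact hy) ⟨y, rfl, hys⟩ ⟨y, rfl, hyt⟩ ?_
  rintro _ rfl z hz hyz
  by_contra! h
  exact hnot ⟨s, hs, t, ht, z, hz, hst, h.1.symm, h.2.symm, hys, hyt, hyz⟩

/-- In a 2-connected graph without `K̂₄`, every vertex outside a wheel has at least three
neighbours in the wheel. -/
theorem hasThreeNbrs_wheel [Finite α] (hfree : ¬ IsInducedMinor hatK4 G)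
    (h2 : ∀ v : α, (G.induce {u | u ≠ v}).Connected) (hc : IsCyclicParam G n c)
    {x : α} (hx : x ∉ Set.range c) (h3 : HasThreeNbrs G (Set.range c) x) {y : α}
    (hy : y ∉ insert x (Set.range c)) : HasThreeNbrs G (insert x (Set.range c)) y := by
  set Z := insert x (Set.range c) with hZdef
  by_contra hnot
  let bad : Set α := {w | w ∉ Z ∧ ¬ HasThreeNbrs G Z w}
  have hbad1 : ∀ w ∈ bad, ∀ s ∈ Z, ∀ t ∈ Z, G.Adj w s → G.Adj w t → s = t := by
    intro w hw s hs t ht hws hwt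
    by_contra hst
    exact hw.2 (hc.hasThreeNbrs_of_two hfree hx h3 hw.1 hs ht hst hws hwt)
  have hfin : {K : Set α | K ⊆ bad ∧ (G.induce K).Connected}.Finite := Set.toFinite _
  have hmem : {y} ∈ {K : Set α | K ⊆ bad ∧ (G.induce K).Connected} :=
    ⟨Set.singleton_subset_iff.2 ⟨hy, hnot⟩, induce_singleton_connected y⟩
  obtain ⟨K, hyK, hK⟩ := hfin.exists_le_maximal hmem
  have hyK : y ∈ K := hyK rfl
  have hKbad : K ⊆ bad := hK.prop.1
  have hKconn : (G.induce K).Connected := hK.prop.2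
  have hKnbr : ∀ a ∈ K, ∀ g, g ∉ K → G.Adj a g → g ∉ bad := by
    intro a ha g hg hag hgbad
    have hle := hK.le_of_ge (y := K ∪ {g})
      ⟨Set.union_subset hKbad (Set.singleton_subset_iff.2 hgbad),
      induce_union_connected_of_touch hKconn (induce_singleton_connected g)
        ⟨a, ha, g, rfl, hag⟩⟩ Set.subset_union_left
    exact hg (hle (Or.inr rfl))
  have hKone : ∀ a ∈ K, ∀ b ∈ K, ∀ s ∈ Z, ∀ t ∈ Z, G.Adj a s → G.Adj b t → s = t := by
    intro a ha b hb
    obtain ⟨p⟩ := hKconn.preconnected ⟨a, ha⟩ ⟨b, hb⟩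
    let q := p.map (Embedding.induce K).toHom
    have hq : ∀ w ∈ q.support, w ∈ K := by
      intro w hw
      rw [Walk.support_map, List.mem_map] at hw
      obtain ⟨w', -, rfl⟩ := hw
      exact w'.2
    exact hc.eq_of_adj_walk hfree hx h3 q (fun w hw => (hKbad (hq w hw)).1)
      (fun w hw => hbad1 w (hKbad (hq w hw))) a q.start_mem_support b q.end_mem_support
  have hKZ : ∀ z ∈ Z, z ∉ K := fun z hz hzK => (hKbad hzK).1 hz
  have hexit : ∀ g, g ∉ K → ∃ a ∈ K, ∃ h, h ∉ K ∧ h ≠ g ∧ G.Adj a h := by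
    intro g hg
    obtain ⟨z, hz, hzg⟩ : ∃ z ∈ Z, z ≠ g := by
      obtain ⟨p, hp, q, hq, -, -, hpq, -⟩ := h3
      by_cases h : p = g
      · exact ⟨q, Or.inr hq, fun h' => hpq (h.trans h'.symm)⟩
      · exact ⟨p, Or.inr hp, h⟩
    obtain ⟨p⟩ := (h2 g).preconnected ⟨y, fun h => hg (h ▸ hyK)⟩ ⟨z, hzg⟩
    obtain ⟨d, -, hd1, hd2⟩ := p.exists_boundary_dart (Subtype.val ⁻¹' K) hyK (hKZ z hz)
    exact ⟨d.fst, hd1, d.snd, hd2, d.snd.2, d.adj⟩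
  have hgood : ∀ a ∈ K, ∀ g, g ∉ K → G.Adj a g → g ∉ Z → HasThreeNbrs G Z g := by
    intro a ha g hg hag hgZ
    by_contra h
    exact hKnbr a ha g hg hag ⟨hgZ, h⟩
  have hother : ∀ g, HasThreeNbrs G Z g → ∀ z, ∃ t ∈ Z, t ≠ z ∧ G.Adj g t := by
    rintro g ⟨p, hp, q, hq, -, -, hpq, -, -, hgp, hgq, -⟩ z
    by_cases h : p = z
    · exact ⟨q, hq, fun h' => hpq (h.trans h'.symm), hgq⟩
    · exact ⟨p, hp, h, hgp⟩
  have hZK : Disjoint Z K := Set.disjoint_left.2 hKZ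
  have hpair : ∀ {g s}, g ∉ Z → ∀ z ∈ Z, z ∈ ({s, g} : Set α) → z = s := by
    rintro g s hg z hz (rfl | rfl)
    · rfl
    · exact absurd hz hg
  obtain ⟨a₁, ha₁, g₁, hg₁K, -, hag₁⟩ := hexit x (hKZ x (Or.inl rfl))
  obtain ⟨a₂, ha₂, g₂, hg₂K, hg₂₁, hag₂⟩ := hexit g₁ hg₁K
  by_cases hKtouch : ∃ a ∈ K, ∃ z ∈ Z, G.Adj a z
  · obtain ⟨a, ha, z, hz, haz⟩ := hKtouch
    obtain ⟨b, hb, g, hgK, hgz, hbg⟩ : ∃ b ∈ K, ∃ g, g ∉ K ∧ g ≠ z ∧ G.Adj b g :=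
      hexit z (hKZ z hz)
    have hgZ : g ∉ Z := fun hg => hgz (hKone b hb a ha g hg z hz hbg haz)
    obtain ⟨t, ht, htz, hgt⟩ := hother g (hgood b hb g hgK hbg hgZ) z
    refine hc.false_of_touch_two hfree hx h3 hz ht htz.symm hKconn
      (induce_singleton_connected z) (induce_pair_connected_of_adj hgt.symm) rfl (Or.inl rfl)
      (fun _ _ h => h) (hpair hgZ) ?_ hZK ?_ ?_ ⟨a, ha, z, rfl, haz⟩
      ⟨b, hb, g, Or.inr rfl, hbg⟩ ?_
    · simp [htz.symm, hgz.symm]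
    · simpa using hKZ z hz
    · simp [hKZ t ht, hgK]
    · intro w hw z' hz' hwz'
      exact Or.inl (hKone w hw a ha z' hz' z hz hwz' haz)
  · have hg₁Z : g₁ ∉ Z := fun h => hKtouch ⟨a₁, ha₁, g₁, h, hag₁⟩
    have hg₂Z : g₂ ∉ Z := fun h => hKtouch ⟨a₂, ha₂, g₂, h, hag₂⟩
    obtain ⟨s, hs, -, hgs⟩ := hother g₁ (hgood a₁ ha₁ g₁ hg₁K hag₁ hg₁Z) x
    obtain ⟨t, ht, hts, hgt⟩ := hother g₂ (hgood a₂ ha₂ g₂ hg₂K hag₂ hg₂Z) s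
    have hsg : s ≠ g₂ := fun h => hg₂Z (h ▸ hs)
    have htg : t ≠ g₁ := fun h => hg₁Z (h ▸ ht)
    refine hc.false_of_touch_two hfree hx h3 hs ht hts.symm hKconn
      (induce_pair_connected_of_adj hgs.symm) (induce_pair_connected_of_adj hgt.symm)
      (Or.inl rfl) (Or.inl rfl) (hpair hg₁Z) (hpair hg₂Z) ?_ hZK ?_ ?_
      ⟨a₁, ha₁, g₁, Or.inr rfl, hag₁⟩ ⟨a₂, ha₂, g₂, Or.inr rfl, hag₂⟩ ?_
    · simp [hts, hsg.symm, hg₂₁, htg]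
    · simp [hKZ s hs, hg₁K]
    · simp [hKZ t ht, hg₂K]
    · intro w hw z hz hwz
      exact absurd ⟨w, hw, z, hz, hwz⟩ hKtouch

end IsCyclicParam

end Wheels

section OutsideCycle

variable {α : Type*} {G : SimpleGraph α} {n : ℕ} {c : ℕ → α}

namespace IsCyclicParam

/-- If three arcs of a cycle each contain a neighbour of `v`, a vertex not adjacent to `v` cannot
see exactly two of them. -/
lemma false_of_two_of_three_arcs (hfree : ¬ IsInducedMinor hatK4 G) (hc : IsCyclicParam G n c)
    {u v : α} (hu : u ∉ Set.range c) (hv : v ∉ Set.range c) (huv : u ≠ v) (hnadj : ¬ G.Adj u v)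
    {i j k a b d e f : ℕ} (ha : i ≤ a ∧ a < j) (hb : j ≤ b ∧ b < k) (hd : k ≤ d ∧ d < i + n)
    (hva : G.Adj v (c a)) (hvb : G.Adj v (c b)) (hvd : G.Adj v (c d))
    (he : i ≤ e ∧ e < j) (hf : j ≤ f ∧ f < k) (hue : G.Adj u (c e)) (huf : G.Adj u (c f))
    (hmiss : ∀ m, k ≤ m → m < i + n → ¬ G.Adj u (c m)) : False := by
  refine hfree ((hc.isK4Model_three_arcs hv ha hb hd hva hvb hvd).isInducedMinor_hatK4
    (induce_singleton_connected u) ?_ (i := 1) (j := 2) (by decide) ?_)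
  · intro r
    fin_cases r
    · exact Set.disjoint_singleton.2 huv.symm
    all_goals exact (disjoint_singleton_arc hu _ _).symm
  · intro r
    fin_cases r
    · refine iff_of_false ?_ (by decide)
      rintro ⟨_, rfl, _, rfl, h⟩
      exact hnadj h
    · exact iff_of_true ⟨u, rfl, _, ⟨e, he, rfl⟩, hue⟩ (by decide)
    · exact iff_of_true ⟨u, rfl, _, ⟨f, hf, rfl⟩, huf⟩ (by decide)
    · refine iff_of_false ?_ (by decide)
      rintro ⟨_, rfl, _, ⟨m, ⟨hm1, hm2⟩, rfl⟩, h⟩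
      exact hmiss m hm1 hm2 h

/-- Nonadjacent vertices with at least three neighbours on a cycle have the same neighbours
there. -/
lemma adj_of_not_adj (hfree : ¬ IsInducedMinor hatK4 G) (hc : IsCyclicParam G n c)
    {u v : α} (hu : u ∉ Set.range c) (hv : v ∉ Set.range c) (huv : u ≠ v) (hnadj : ¬ G.Adj u v)
    (hu3 : HasThreeNbrs G (Set.range c) u) (hv3 : HasThreeNbrs G (Set.range c) v)
    {p : ℕ} (hvp : G.Adj v (c p)) : G.Adj u (c p) := by
  by_contra hup
  obtain ⟨a₀, a₁, a₂, _, _, ha, ha₂, -, hva₁, hva₂⟩ := hc.exists_ordered_nbrs hv3 p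
  obtain ⟨e₀, e, f, _, _, hef, hf, -, hue, huf⟩ := hc.exists_ordered_nbrs hu3 p
  have hvp' : G.Adj v (c (p + n)) := by rwa [hc.add_period]
  have hcross : ∀ e f, p < e → e < f → f < p + n → G.Adj u (c e) → G.Adj u (c f) →
      a₁ < f → e < a₂ → False := by
    intro e f hpe hef hf hue huf h1 h2
    refine hc.false_of_two_of_three_arcs hfree hu hv huv hnadj (i := p + 1)
      (j := max a₁ e + 1) (k := p + n) ⟨by omega, by omega⟩ ⟨by omega, ha₂⟩
      ⟨le_rfl, by omega⟩ hva₁ hva₂ hvp' ⟨by omega, by omega⟩ ⟨by omega, hf⟩ hue huf ?_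
    intro m hm1 hm2 hum
    obtain rfl : m = p + n := by omega
    rw [hc.add_period] at hum
    exact hup hum
  rcases lt_or_ge a₁ f with h1 | h1
  · rcases lt_or_ge e a₂ with h2 | h2
    · exact hcross e f (by omega) hef hf hue huf h1 h2
    · have hva₁' : G.Adj v (c (a₁ + n)) := by rwa [hc.add_period]
      refine hc.false_of_two_of_three_arcs hfree hu hv huv hnadj (i := a₂) (j := f)
        (k := p + n + 1) ⟨le_rfl, by omega⟩ ⟨by omega, by omega⟩ ⟨by omega, by omega⟩
        hva₂ hvp' hva₁' ⟨h2, hef⟩ ⟨le_rfl, by omega⟩ hue huf ?_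
      intro m hm1 hm2 hum
      obtain ⟨m, rfl⟩ : ∃ m', m = m' + n := ⟨m - n, by omega⟩
      rw [hc.add_period] at hum
      exact hcross m e (by omega) (by omega) (by omega) hum hue (by omega) (by omega)
  · refine hc.false_of_two_of_three_arcs hfree hu hv huv hnadj (i := p) (j := e + 1)
      (k := a₁ + 1) ⟨le_rfl, by omega⟩ ⟨by omega, by omega⟩ ⟨by omega, ha₂⟩
      hvp hva₁ hva₂ ⟨by omega, by omega⟩ ⟨hef, by omega⟩ hue huf ?_
    intro m hm1 hm2 hum
    exact hcross e m (by omega) (by omega) hm2 hue hum (by omega) (by omega)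

/-- Adjacent vertices `v`, `w` and a vertex `u` adjacent to neither cannot have the same
neighbours on a cycle. -/
lemma false_of_same_nbrs (hfree : ¬ IsInducedMinor hatK4 G) (hc : IsCyclicParam G n c)
    {u v w : α} (hu : u ∉ Set.range c) (hv : v ∉ Set.range c) (hw : w ∉ Set.range c)
    (hvw : G.Adj v w) (huv : ¬ G.Adj u v) (huw : ¬ G.Adj u w)
    (hu3 : HasThreeNbrs G (Set.range c) u) (hadj_v : ∀ p, G.Adj u (c p) → G.Adj v (c p))
    (hadj_w : ∀ p, G.Adj u (c p) → G.Adj w (c p)) : False := by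
  obtain ⟨a, b, d, _, hab, _, _, hua, hub, -⟩ := hc.exists_ordered_nbrs hu3 0
  have haM : c a ∈ c '' Set.Ico a b := ⟨a, ⟨le_rfl, hab⟩, rfl⟩
  have hbM : c b ∈ c '' Set.Ico b (a + n) := ⟨b, ⟨le_rfl, by omega⟩, rfl⟩
  have hM : IsK4Model G ![{v}, {w}, c '' Set.Ico a b, c '' Set.Ico b (a + n)] :=
    IsK4Model.of_sets (induce_singleton_connected v) (induce_singleton_connected w)
      (hc.connected_arc hab) (hc.connected_arc (by omega)) (Set.disjoint_singleton.2 hvw.ne)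
      (disjoint_singleton_arc hv _ _) (disjoint_singleton_arc hv _ _)
      (disjoint_singleton_arc hw _ _) (disjoint_singleton_arc hw _ _)
      (hc.disjoint_arcs le_rfl le_rfl) ⟨v, rfl, w, rfl, hvw⟩
      ⟨v, rfl, _, haM, hadj_v a hua⟩ ⟨v, rfl, _, hbM, hadj_v b hub⟩
      ⟨w, rfl, _, haM, hadj_w a hua⟩ ⟨w, rfl, _, hbM, hadj_w b hub⟩
      (hc.touch_arcs hab (by omega))
  refine hfree (hM.isInducedMinor_hatK4 (induce_singleton_connected u) ?_
    (i := 2) (j := 3) (by decide) ?_)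
  · intro r
    fin_cases r
    · exact Set.disjoint_singleton.2 (by rintro rfl; exact huw hvw)
    · exact Set.disjoint_singleton.2 (by rintro rfl; exact huv hvw.symm)
    all_goals exact (disjoint_singleton_arc hu _ _).symm
  · intro r
    fin_cases r
    · refine iff_of_false ?_ (by decide)
      rintro ⟨_, rfl, _, rfl, h⟩
      exact huv h
    · refine iff_of_false ?_ (by decide)
      rintro ⟨_, rfl, _, rfl, h⟩
      exact huw h
    · exact iff_of_true ⟨u, rfl, _, haM, hua⟩ (by decide)
    · exact iff_of_true ⟨u, rfl, _, hbM, hub⟩ (by decide)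

/-- If `r`, `v`, `w` is a triangle outside a cycle and `u` sees `r` but neither `v` nor `w`, then
not all four see the cycle. -/
lemma false_of_triangle (hfree : ¬ IsInducedMinor hatK4 G) (hc : IsCyclicParam G n c)
    {r u v w : α} (hr : r ∉ Set.range c) (hu : u ∉ Set.range c) (hv : v ∉ Set.range c)
    (hw : w ∉ Set.range c) (hvw : G.Adj v w) (huv : ¬ G.Adj u v) (huw : ¬ G.Adj u w)
    (hur : G.Adj u r) (hvr : G.Adj v r) (hwr : G.Adj w r)
    (hrc : ∃ z ∈ Set.range c, G.Adj r z) (huc : ∃ z ∈ Set.range c, G.Adj u z)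
    (hvc : ∃ z ∈ Set.range c, G.Adj v z) (hwc : ∃ z ∈ Set.range c, G.Adj w z) : False := by
  have hcycle : c '' Set.Ico 0 (0 + n) = Set.range c := by
    refine (Set.image_subset_range _ _).antisymm fun z hz => ?_
    obtain ⟨m, h1, h2, rfl⟩ := hc.exists_mem_window 0 hz
    exact ⟨m, ⟨h1, h2⟩, rfl⟩
  have hconn : (G.induce (Set.range c)).Connected :=
    hcycle ▸ hc.connected_arc (by have := hc.pos; omega)
  have hM : IsK4Model G ![{r}, Set.range c, {v}, {w}] :=
    IsK4Model.of_sets (induce_singleton_connected r) hconn (induce_singleton_connected v)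
      (induce_singleton_connected w) (Set.disjoint_singleton_left.2 hr)
      (Set.disjoint_singleton.2 hvr.ne') (Set.disjoint_singleton.2 hwr.ne')
      (Set.disjoint_singleton_right.2 hv) (Set.disjoint_singleton_right.2 hw)
      (Set.disjoint_singleton.2 hvw.ne) ⟨r, rfl, hrc⟩ ⟨r, rfl, v, rfl, hvr.symm⟩
      ⟨r, rfl, w, rfl, hwr.symm⟩ (Touch.symm ⟨v, rfl, hvc⟩) (Touch.symm ⟨w, rfl, hwc⟩)
      ⟨v, rfl, w, rfl, hvw⟩
  refine hfree (hM.isInducedMinor_hatK4 (induce_singleton_connected u) ?_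
    (i := 0) (j := 1) (by decide) ?_)
  · intro k
    fin_cases k
    · exact Set.disjoint_singleton.2 hur.ne'
    · exact Set.disjoint_singleton_right.2 hu
    · exact Set.disjoint_singleton.2 (by rintro rfl; exact huw hvw)
    · exact Set.disjoint_singleton.2 (by rintro rfl; exact huv hvw.symm)
  · intro k
    fin_cases k
    · exact iff_of_true ⟨u, rfl, r, rfl, hur⟩ (by decide)
    · exact iff_of_true ⟨u, rfl, huc⟩ (by decide)
    · refine iff_of_false ?_ (by decide)
      rintro ⟨_, rfl, _, rfl, h⟩
      exact huv h
    · refine iff_of_false ?_ (by decide)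
      rintro ⟨_, rfl, _, rfl, h⟩
      exact huw h

end IsCyclicParam

lemma HasThreeNbrs.of_insert {S : Set α} {x y : α} (h : HasThreeNbrs G (insert x S) y)
    (hyx : ¬ G.Adj y x) : HasThreeNbrs G S y := by
  obtain ⟨p, hp, q, hq, r, hr, hpq, hpr, hqr, hyp, hyq, hyr⟩ := h
  have key : ∀ z ∈ insert x S, G.Adj y z → z ∈ S := by
    rintro z (rfl | hz) hyz
    · exact absurd hyz hyx
    · exact hz
  exact ⟨p, key p hp hyp, q, key q hq hyq, r, key r hr hyr, hpq, hpr, hqr, hyp, hyq, hyr⟩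

lemma HasThreeNbrs.exists_adj_of_insert {S : Set α} {x y : α}
    (h : HasThreeNbrs G (insert x S) y) : ∃ z ∈ S, G.Adj y z := by
  obtain ⟨p, hp, q, hq, -, -, hpq, -, -, hyp, hyq, -⟩ := h
  rcases hp with rfl | hp
  · exact ⟨q, hq.resolve_left hpq.symm, hyq⟩
  · exact ⟨p, hp, hyp⟩

/-- In a 2-connected graph without `K̂₄`, no vertex outside the cycle of a wheel misses both ends
of an edge outside that cycle. -/
theorem IsCyclicParam.adj_or_adj_of_adj [Finite α] (hfree : ¬ IsInducedMinor hatK4 G)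
    (h2 : ∀ v : α, (G.induce {u | u ≠ v}).Connected) (hc : IsCyclicParam G n c)
    {r u v w : α} (hr : r ∉ Set.range c) (hr3 : HasThreeNbrs G (Set.range c) r)
    (hu : u ∉ Set.range c) (hv : v ∉ Set.range c) (hw : w ∉ Set.range c)
    (hvw : G.Adj v w) : G.Adj u v ∨ G.Adj u w := by
  by_contra! h
  obtain ⟨huv, huw⟩ := h
  have huv' : u ≠ v := by rintro rfl; exact huw hvw
  have huw' : u ≠ w := by rintro rfl; exact huv hvw.symm
  have hwheel : ∀ x, x ∉ Set.range c → HasThreeNbrs G (Set.range c) x → ∀ y, y ∉ Set.range c →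
      y ≠ x → HasThreeNbrs G (insert x (Set.range c)) y := by
    intro x hx hx3 y hy hyx
    exact hc.hasThreeNbrs_wheel hfree h2 hx hx3 (by rintro (h | h) <;> contradiction)
  have hspread : ∀ x, x ∉ Set.range c → HasThreeNbrs G (Set.range c) x → ∀ y, y ∉ Set.range c →
      ¬ G.Adj y x → HasThreeNbrs G (Set.range c) y := by
    intro x hx hx3 y hy hyx
    by_cases hxy : y = x
    · exact hxy ▸ hx3
    · exact (hwheel x hx hx3 y hy hxy).of_insert hyx
  have huv_symm : ¬ G.Adj v u := fun h => huv h.symm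
  have huw_symm : ¬ G.Adj w u := fun h => huw h.symm
  by_cases hu3 : HasThreeNbrs G (Set.range c) u
  · have hv3 := hspread u hu hu3 v hv huv_symm
    have hw3 := hspread u hu hu3 w hw huw_symm
    exact hc.false_of_same_nbrs hfree hu hv hw hvw huv huw hu3
      (fun p hp => hc.adj_of_not_adj hfree hv hu huv'.symm huv_symm hv3 hu3 hp)
      (fun p hp => hc.adj_of_not_adj hfree hw hu huw'.symm huw_symm hw3 hu3 hp)
  · have hv3 : ¬ HasThreeNbrs G (Set.range c) v := fun h => hu3 (hspread v hv h u hu huv)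
    have hw3 : ¬ HasThreeNbrs G (Set.range c) w := fun h => hu3 (hspread w hw h u hu huw)
    have hadj_r : ∀ y, y ∉ Set.range c → ¬ HasThreeNbrs G (Set.range c) y →
        G.Adj y r ∧ ∃ z ∈ Set.range c, G.Adj y z := by
      intro y hy hy3
      refine ⟨by_contra fun h => hy3 (hspread r hr hr3 y hy h), ?_⟩
      exact (hwheel r hr hr3 y hy (by rintro rfl; exact hy3 hr3)).exists_adj_of_insert
    obtain ⟨hur, huc⟩ := hadj_r u hu hu3
    obtain ⟨hvr, hvc⟩ := hadj_r v hv hv3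
    obtain ⟨hwr, hwc⟩ := hadj_r w hw hw3
    obtain ⟨p, hp, -, -, -, -, -, -, -, hrp, -⟩ := hr3
    exact hc.false_of_triangle hfree hr hu hv hw hvw huv huw hur hvr hwr ⟨p, hp, hrp⟩ huc hvc hwc

lemma isCompleteMultipartite_of_adj_or_adj (h : ∀ u v w, G.Adj v w → G.Adj u v ∨ G.Adj u w) :
    IsCompleteMultipartite G := by
  refine ⟨⟨fun u v => ¬ G.Adj u v, fun u => G.irrefl, fun huv hvu => huv hvu.symm, ?_⟩, ?_⟩
  · intro u v w huv hvw huw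
    rcases h v u w huw with hvu | h'
    · exact huv hvu.symm
    · exact hvw h'
  · intro u v
    exact not_not.symm

end OutsideCycle

/-- The graph induced outside the cycle of a minimum 3-wheel is complete
multipartite. -/
theorem outside_cycle_completeMultipartite {α : Type*} [Fintype α] [DecidableEq α]
    (G : SimpleGraph α)
    (h2 : TwoConnected G) (hfree : ¬ IsInducedMinor hatK4 G)
    (hprop : HasProperK4Subdivision G)
    (W : ThreeWheelSub G) (hmin : ∀ W' : ThreeWheelSub G, W.order ≤ W'.order) :
    IsCompleteMultipartite (G.induce {v | v ∉ W.cyc.support}) := by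
  obtain ⟨n, c, hc, hrange⟩ := exists_isCyclicParam W.cyc_isCycle
  have hmem : ∀ z, z ∈ Set.range c ↔ z ∈ W.cyc.support := fun z => by rw [hrange]; rfl
  have hcenter : HasThreeNbrs G (Set.range c) W.center := by
    obtain ⟨p, q, r, hpq, hpr, hqr, hs⟩ := Finset.card_eq_three.1 W.spokes_card
    have hp : p ∈ W.spokes := by simp [hs]
    have hq : q ∈ W.spokes := by simp [hs]
    have hr : r ∈ W.spokes := by simp [hs]
    exact ⟨p, (hmem p).2 (W.spokes_sub p hp), q, (hmem q).2 (W.spokes_sub q hq),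
      r, (hmem r).2 (W.spokes_sub r hr), hpq, hpr, hqr,
      W.spokes_adj p hp, W.spokes_adj q hq, W.spokes_adj r hr⟩
  refine isCompleteMultipartite_of_adj_or_adj fun u v w hvw => ?_
  have hout : ∀ y : {v // v ∉ W.cyc.support}, y.1 ∉ Set.range c := fun y h => y.2 ((hmem _).1 h)
  exact hc.adj_or_adj_of_adj hfree h2.2 (fun h => W.center_not_mem ((hmem _).1 h)) hcenter
    (hout u) (hout v) (hout w) hvw

end IMWQO
end

section
/- If a finite simple graph G can be obtained by adding one new edge between two non-adjacent vertices of a graph that is a subdivision of the prism, then G has a proper K₄-subdivision. -/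
open SimpleGraph

namespace IMWQO

/-- `S` is, up to isolated vertices, a subdivision of `K₄` living on the vertex type `V`. -/
inductive IsK4Subdiv {V : Type*} : SimpleGraph V → Prop
  | base (S : SimpleGraph V) (a b c d : V) (hab : a ≠ b) (hac : a ≠ c) (had : a ≠ d)
      (hbc : b ≠ c) (hbd : b ≠ d) (hcd : c ≠ d)
      (hS : ∀ p q, S.Adj p q ↔ p ≠ q ∧ (p = a ∨ p = b ∨ p = c ∨ p = d) ∧
        (q = a ∨ q = b ∨ q = c ∨ q = d)) : IsK4Subdiv S
  | step (S S' : SimpleGraph V) (x y w : V) (h : IsK4Subdiv S) (hxy : S.Adj x y)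
      (hw : ∀ z, ¬ S.Adj w z)
      (hS' : ∀ p q, S'.Adj p q ↔ (S.Adj p q ∧ ¬(p = x ∧ q = y) ∧ ¬(p = y ∧ q = x)) ∨
        (p = w ∧ (q = x ∨ q = y)) ∨ (q = w ∧ (p = x ∨ p = y))) : IsK4Subdiv S'

theorem IsK4Subdiv.exists_complete {V : Type*} {a b c d : V} (hab : a ≠ b) (hac : a ≠ c)
    (had : a ≠ d) (hbc : b ≠ c) (hbd : b ≠ d) (hcd : c ≠ d) :
    ∃ S : SimpleGraph V, IsK4Subdiv S ∧
      ∀ p q, S.Adj p q ↔ p ≠ q ∧ (p = a ∨ p = b ∨ p = c ∨ p = d) ∧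
        (q = a ∨ q = b ∨ q = c ∨ q = d) := by
  let S : SimpleGraph V :=
    { Adj := fun p q => p ≠ q ∧ (p = a ∨ p = b ∨ p = c ∨ p = d) ∧
        (q = a ∨ q = b ∨ q = c ∨ q = d)
      symm := ⟨fun p q h => ⟨h.1.symm, h.2.2, h.2.1⟩⟩
      loopless := ⟨fun p h => h.1 rfl⟩ }
  exact ⟨S, .base S a b c d hab hac had hbc hbd hcd fun _ _ => Iff.rfl, fun _ _ => Iff.rfl⟩

theorem IsK4Subdiv.exists_subdivide {V : Type*} {S : SimpleGraph V} (h : IsK4Subdiv S)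
    {x y w : V} (hxy : S.Adj x y) (hw : ∀ z, ¬ S.Adj w z) :
    ∃ S' : SimpleGraph V, IsK4Subdiv S' ∧
      ∀ p q, S'.Adj p q ↔ (S.Adj p q ∧ ¬(p = x ∧ q = y) ∧ ¬(p = y ∧ q = x)) ∨
        (p = w ∧ (q = x ∨ q = y)) ∨ (q = w ∧ (p = x ∨ p = y)) := by
  have hwx : w ≠ x := fun e => hw y (e ▸ hxy)
  have hwy : w ≠ y := fun e => hw x (e ▸ hxy.symm)
  let S' : SimpleGraph V :=
    { Adj := fun p q => (S.Adj p q ∧ ¬(p = x ∧ q = y) ∧ ¬(p = y ∧ q = x)) ∨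
        (p = w ∧ (q = x ∨ q = y)) ∨ (q = w ∧ (p = x ∨ p = y))
      symm := ⟨fun p q h => by have := S.adj_comm p q; tauto⟩
      loopless := ⟨fun p h => by have := S.irrefl (v := p); grind⟩ }
  exact ⟨S', .step S S' x y w h hxy hw fun _ _ => Iff.rfl, fun _ _ => Iff.rfl⟩

/-- Variant of `IsK4Subdiv.exists_subdivide` where the new vertex may also be an end of the
edge, in which case nothing changes. -/
theorem IsK4Subdiv.exists_subdivide_or_eq {V : Type*} {S : SimpleGraph V} (h : IsK4Subdiv S)
    {x y w : V} (hxy : S.Adj x y) (hw : w = x ∨ w = y ∨ ∀ z, ¬ S.Adj w z) :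
    ∃ S' : SimpleGraph V, IsK4Subdiv S' ∧
      ∀ p q, S'.Adj p q ↔ (S.Adj p q ∧ ¬(p = x ∧ q = y) ∧ ¬(p = y ∧ q = x)) ∨
        (p ≠ q ∧ ((p = w ∧ (q = x ∨ q = y)) ∨ (q = w ∧ (p = x ∨ p = y)))) := by
  have hyx := hxy.symm
  have hne := hxy.ne
  rcases hw with rfl | rfl | hw
  · exact ⟨S, h, by grind⟩
  · exact ⟨S, h, by grind⟩
  · obtain ⟨S', h', hS'⟩ := h.exists_subdivide hxy hw
    refine ⟨S', h', fun p q => ?_⟩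
    rw [hS']
    have hwx : w ≠ x := fun e => hw y (e ▸ hxy)
    have hwy : w ≠ y := fun e => hw x (e ▸ hyx)
    grind

theorem IsK4Subdiv.comap {V W : Type*} {S : SimpleGraph W} (h : IsK4Subdiv S) {f : V → W}
    (hf : Function.Injective f) (hr : ∀ x y, S.Adj x y → ∃ a, f a = x) :
    IsK4Subdiv (S.comap f) := by
  induction h with
  | base S a b c d hab hac had hbc hbd hcd hS =>
    obtain ⟨a, rfl⟩ := hr a b (by grind)
    obtain ⟨b, rfl⟩ := hr b (f a) (by grind)
    obtain ⟨c, rfl⟩ := hr c (f a) (by grind)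
    obtain ⟨d, rfl⟩ := hr d (f a) (by grind)
    refine .base _ a b c d (by grind) (by grind) (by grind) (by grind) (by grind) (by grind) ?_
    intro p q
    simp only [comap_adj, hS, hf.eq_iff, ne_eq]
  | step S S' x y w h hxy hw hS' ih =>
    obtain ⟨w, rfl⟩ := hr w x (by grind)
    obtain ⟨x, rfl⟩ := hr x (f w) (by grind)
    obtain ⟨y, rfl⟩ := hr y (f w) (by grind)
    refine .step (S.comap f) _ x y w (ih ?_) hxy (fun z => hw _) ?_
    · intro p q hpq
      by_cases h1 : p = f x
      · exact ⟨x, h1.symm⟩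
      by_cases h2 : p = f y
      · exact ⟨y, h2.symm⟩
      exact hr p q (by grind)
    · intro p q
      simp only [comap_adj, hS', hf.eq_iff]

theorem IsK4Subdiv.map {V W : Type*} {S : SimpleGraph V} (h : IsK4Subdiv S) (f : V ↪ W) :
    IsK4Subdiv (S.map f) := by
  have hf := f.injective
  induction h with
  | base S a b c d hab hac had hbc hbd hcd hS =>
    refine .base _ (f a) (f b) (f c) (f d) (hf.ne hab) (hf.ne hac) (hf.ne had) (hf.ne hbc)
      (hf.ne hbd) (hf.ne hcd) fun p q => ?_
    simp only [map_adj, hS]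
    constructor
    · rintro ⟨p, q, ⟨hne, hp, hq⟩, rfl, rfl⟩
      simpa only [hf.eq_iff, ne_eq] using ⟨hne, hp, hq⟩
    · rintro ⟨hne, rfl | rfl | rfl | rfl, rfl | rfl | rfl | rfl⟩ <;>
        exact ⟨_, _, ⟨fun e => hne (congrArg f e), by simp, by simp⟩, rfl, rfl⟩
  | step S S' x y w h hxy hw hS' ih =>
    refine .step (S.map f) _ (f x) (f y) (f w) ih
      ⟨hf.ne hxy.ne, x, y, hxy, rfl, rfl⟩ ?_ fun p q => ?_
    · rintro z ⟨-, a, b, hab, ha, rfl⟩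
      exact hw b (hf ha ▸ hab)
    · simp only [map_adj, hS']
      constructor
      · rintro ⟨p, q, h, rfl, rfl⟩
        refine h.imp (fun h => ⟨⟨p, q, h.1, rfl, rfl⟩, ?_⟩) (fun h => ?_)
        · simpa only [hf.eq_iff] using h.2
        · simpa only [hf.eq_iff] using h
      · rintro (⟨⟨p, q, hpq, rfl, rfl⟩, h⟩ | ⟨rfl, rfl | rfl⟩ | ⟨rfl, rfl | rfl⟩)
        · simp only [hf.eq_iff] at h
          exact ⟨p, q, .inl ⟨hpq, h⟩, rfl, rfl⟩
        all_goals exact ⟨_, _, .inr (by simp), rfl, rfl⟩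

theorem subdivideEdge_adj {n : ℕ} (G : SimpleGraph (Fin n)) (u v : Fin n) (a b : Fin (n + 1)) :
    (subdivideEdge G u v).Adj a b ↔
      (∃ a' b' : Fin n, a = a'.castSucc ∧ b = b'.castSucc ∧ G.Adj a' b' ∧
        ¬(a' = u ∧ b' = v) ∧ ¬(a' = v ∧ b' = u)) ∨
      (a = Fin.last n ∧ (b = u.castSucc ∨ b = v.castSucc)) ∨
      (b = Fin.last n ∧ (a = u.castSucc ∨ a = v.castSucc)) := by
  have hu := Fin.castSucc_ne_last u
  have hv := Fin.castSucc_ne_last v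
  simp only [subdivideEdge, fromRel_adj]
  constructor
  · rintro ⟨hne, (h | h) | (⟨a', b', rfl, rfl, h, h1, h2⟩ | h)⟩
    · exact .inl h
    · exact .inr (.inl h)
    · exact .inl ⟨b', a', rfl, rfl, h.symm, by tauto, by tauto⟩
    · exact .inr (.inr h)
  · rintro (⟨a', b', rfl, rfl, h⟩ | h | h)
    · exact ⟨fun e => h.1.ne (Fin.castSucc_injective n e), .inl (.inl ⟨a', b', rfl, rfl, h⟩)⟩
    · exact ⟨by grind, .inl (.inr h)⟩
    · exact ⟨by grind, .inr (.inr h)⟩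

theorem subdivideEdge_adj_castSucc {n : ℕ} (G : SimpleGraph (Fin n)) (u v a b : Fin n) :
    (subdivideEdge G u v).Adj a.castSucc b.castSucc ↔
      G.Adj a b ∧ ¬(a = u ∧ b = v) ∧ ¬(a = v ∧ b = u) := by
  rw [subdivideEdge_adj]
  simp [Fin.castSucc_ne_last]

theorem subdivideEdge_adj_last_left {n : ℕ} (G : SimpleGraph (Fin n)) (u v : Fin n)
    (b : Fin (n + 1)) : (subdivideEdge G u v).Adj (Fin.last n) b ↔
      b = u.castSucc ∨ b = v.castSucc := by
  rw [subdivideEdge_adj]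
  simp [(Fin.castSucc_ne_last _).symm]

/-- The non-isolated part of `S` is realised by a chain of subdivision steps from `K₄`. -/
theorem IsK4Subdiv.exists_chain {V : Type*} {S : SimpleGraph V} (h : IsK4Subdiv S) :
    ∃ (n : ℕ) (A : SimpleGraph (Fin n)) (f : Fin n → V), Function.Injective f ∧
      (∀ x, (∃ i, f i = x) ↔ ∃ y, S.Adj x y) ∧
      (∀ i j, A.Adj i j ↔ S.Adj (f i) (f j)) ∧
      Relation.ReflTransGen SubdivStep ⟨n, A⟩ ⟨4, K4⟩ := by
  induction h with
  | base S a b c d hab hac had hbc hbd hcd hS =>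
    have hinj : Function.Injective ![a, b, c, d] := by
      intro i j; fin_cases i <;> fin_cases j <;> simp_all [eq_comm]
    refine ⟨4, K4, ![a, b, c, d], hinj, ?_, ?_, .refl⟩
    · intro x
      simp only [Fin.exists_fin_succ, hS]
      simp
      constructor
      · rintro (rfl | rfl | rfl | rfl)
        · exact ⟨b, by grind⟩
        all_goals exact ⟨a, by grind⟩
      · grind
    · intro i j
      have hm : ∀ i, ![a, b, c, d] i = a ∨ ![a, b, c, d] i = b ∨ ![a, b, c, d] i = c ∨
          ![a, b, c, d] i = d := by
        intro i; fin_cases i <;> simp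
      simp only [hS, hm, K4, top_adj, hinj.ne_iff, and_true]
  | step S S' x y w h hxy hw hS' ih =>
    obtain ⟨n, A, f, hf, hr, hA, hc⟩ := ih
    obtain ⟨i, rfl⟩ := (hr x).2 ⟨y, hxy⟩
    obtain ⟨j, rfl⟩ := (hr y).2 ⟨_, hxy.symm⟩
    have hwf : ∀ k, f k ≠ w := fun k e => by
      obtain ⟨z, hz⟩ := (hr w).1 ⟨k, e⟩
      exact hw z hz
    have hw' : ∀ z, ¬ S.Adj z w := fun z hz => hw z hz.symm
    refine ⟨n + 1, subdivideEdge A i j, Fin.snoc f w, ?_, ?_, ?_,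
      .head (.mk A i j ((hA i j).2 hxy)) hc⟩
    · rw [Fin.snoc_injective_iff]
      exact ⟨hf, fun ⟨k, hk⟩ => hwf k hk⟩
    · intro p
      rw [Fin.exists_fin_succ']
      simp only [Fin.snoc_castSucc, Fin.snoc_last, hr]
      constructor
      · rintro (⟨q, hq⟩ | rfl)
        · by_cases h1 : p = f i
          · exact ⟨w, by grind⟩
          by_cases h2 : p = f j
          · exact ⟨w, by grind⟩
          exact ⟨q, by grind⟩
        · exact ⟨f i, by grind⟩
      · rintro ⟨q, hq⟩
        rcases (hS' p q).1 hq with h | h | h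
        · exact .inl ⟨q, h.1⟩
        · exact .inr h.1.symm
        · rcases h.2 with rfl | rfl
          · exact .inl ⟨_, hxy⟩
          · exact .inl ⟨_, hxy.symm⟩
    · intro p q
      induction p using Fin.lastCases with
      | last =>
        rw [subdivideEdge_adj_last_left]
        induction q using Fin.lastCases with
        | last => simp [(Fin.castSucc_ne_last _).symm]
        | cast q => simp [hS', hwf, hf.eq_iff, hw, (hwf _).symm]
      | cast p =>
        induction q using Fin.lastCases with
        | last =>
          rw [adj_comm, subdivideEdge_adj_last_left]
          simp [hS', hwf, hf.eq_iff, hw', (hwf _).symm]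
        | cast q =>
          rw [subdivideEdge_adj_castSucc]
          simp [hS', hwf, hf.eq_iff, hA]

theorem IsK4Subdiv.hasProperK4Subdivision {V : Type*} {S G : SimpleGraph V} (h : IsK4Subdiv S)
    (hle : S ≤ G) {v : V} (hv : ∀ z, ¬ S.Adj v z) : HasProperK4Subdivision G := by
  obtain ⟨n, A, f, hf, hr, hA, hc⟩ := h.exists_chain
  have hfv : ∀ i, f i ≠ v := fun i e => by
    obtain ⟨z, hz⟩ := (hr v).1 ⟨i, e⟩
    exact hv z hz
  refine ⟨v, ⟨{x | ∃ i, f i = x}, fun x y => S.Adj x y, ?_, ?_, ?_⟩,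
    ⟨n, A⟩, ⟨4, K4⟩, ⟨?_⟩, ⟨Iso.refl⟩, hc⟩
  · intro x y hxy
    exact hle hxy
  · intro x y hxy
    exact (hr x).2 ⟨y, hxy⟩
  · exact ⟨fun x y hxy => S.adj_symm hxy⟩
  · refine Iso.symm ⟨Equiv.ofBijective (fun i => ⟨⟨f i, hfv i⟩, i, rfl⟩) ⟨?_, ?_⟩, ?_⟩
    · intro i j hij
      exact hf (by simpa using hij)
    · rintro ⟨⟨x, hx⟩, i, hi⟩
      exact ⟨i, by simpa using hi⟩
    · intro i j
      exact (hA i j).symm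

/-- Edges of `S` inside a column of `Fin 3 × ℕ` can be replaced by the column segments
they span. -/
theorem IsK4Subdiv.exists_fill {E : Fin 3 × ℕ → Fin 3 × ℕ → Prop}
    {S : SimpleGraph (Fin 3 × ℕ)} (h : IsK4Subdiv S) (D : Finset (Fin 3 × ℕ))
    (hE : ∀ x y, E x y → E y x)
    (hcol : ∀ i m, (i, m) ∈ D → (i, m + 1) ∈ D → E (i, m) (i, m + 1))
    (hS : ∀ x y, S.Adj x y → x ∈ D ∧ (E x y ∨ (x.1 = y.1 ∧ ∀ m,
      (x.2 < m ∧ m < y.2 ∨ y.2 < m ∧ m < x.2) → (x.1, m) ∈ D ∧ ∀ z, ¬ S.Adj (x.1, m) z))) :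
    ∃ S' : SimpleGraph (Fin 3 × ℕ), IsK4Subdiv S' ∧ ∀ x y, S'.Adj x y → x ∈ D ∧ E x y := by
  classical
  induction hn : (D.filter fun d => ∀ z, ¬ S.Adj d z).card using Nat.strong_induction_on
    generalizing S with
  | _ n ih =>
  by_cases hall : ∀ x y, S.Adj x y → E x y
  · exact ⟨S, h, fun x y hxy => ⟨(hS x y hxy).1, hall x y hxy⟩⟩
  obtain ⟨i, k, l, hkl, hadj, hnE⟩ : ∃ i k l, k < l ∧ S.Adj (i, k) (i, l) ∧
      ¬ E (i, k) (i, l) := by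
    push Not at hall
    obtain ⟨⟨i, k⟩, ⟨j, l⟩, hadj, hnE⟩ := hall
    obtain rfl : i = j := by have := (hS _ _ hadj).2; grind
    rcases lt_trichotomy k l with hlt | rfl | hlt
    · exact ⟨i, k, l, hlt, hadj, hnE⟩
    · exact (hadj.ne rfl).elim
    · exact ⟨i, l, k, hlt, hadj.symm, fun e => hnE (hE _ _ e)⟩
  have hbetween : ∀ m, k < m → m < l → (i, m) ∈ D ∧ ∀ z, ¬ S.Adj (i, m) z := by
    have := (hS _ _ hadj).2; grind
  have hkD := (hS _ _ hadj).1
  have hlD := (hS _ _ hadj.symm).1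
  have hlt : k + 1 < l := by
    rcases Nat.lt_or_ge (k + 1) l with h1 | h1
    · exact h1
    · obtain rfl : l = k + 1 := by omega
      exact (hnE (hcol i k hkD hlD)).elim
  obtain ⟨hwD, hw⟩ := hbetween (k + 1) (by omega) hlt
  obtain ⟨S', hS'1, hS'⟩ := h.exists_subdivide hadj hw
  refine ih _ ?_ hS'1 ?_ rfl
  · rw [← hn]
    apply Finset.card_lt_card
    rw [Finset.ssubset_iff_of_subset]
    · refine ⟨(i, k + 1), by simp [hwD, hw], ?_⟩
      simp only [Finset.mem_filter, not_and, not_forall, not_not]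
      exact fun _ => ⟨(i, k), by grind⟩
    · intro d hd
      simp only [Finset.mem_filter] at hd ⊢
      refine ⟨hd.1, fun z hz => ?_⟩
      by_cases h1 : d = (i, k)
      · exact hd.2 (i, k + 1) (by grind)
      by_cases h2 : d = (i, l)
      · exact hd.2 (i, k + 1) (by grind)
      exact hd.2 z (by grind)
  · have hiso : ∀ p, (∀ z, ¬ S.Adj p z) → p ≠ (i, k + 1) → ∀ z, ¬ S'.Adj p z := by
      intro p hp hne z hz
      have h1 : p ≠ (i, k) := fun e => hp (i, l) (e ▸ hadj)
      have h2 : p ≠ (i, l) := fun e => hp (i, k) (e ▸ hadj.symm)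
      have := hp z
      grind
    have hE' := hcol i k hkD hwD
    have hE'' := hE _ _ hE'
    have hseg : ∀ m, k + 1 < m → m < l → (i, m) ∈ D ∧ ∀ z, ¬ S'.Adj (i, m) z :=
      fun m h1 h2 => ⟨(hbetween m (by omega) h2).1,
        hiso _ (hbetween m (by omega) h2).2 (by grind)⟩
    intro x y hxy
    rcases (hS' x y).1 hxy with ⟨h1, h2, h3⟩ | ⟨rfl, rfl | rfl⟩ | ⟨rfl, rfl | rfl⟩
    · refine ⟨(hS x y h1).1, (hS x y h1).2.imp_right fun ⟨h4, h5⟩ => ⟨h4, fun m hm => ?_⟩⟩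
      refine ⟨(h5 m hm).1, hiso _ (h5 m hm).2 ?_⟩
      rintro heq
      obtain ⟨rfl, rfl⟩ := Prod.mk.inj heq
      obtain ⟨x1, x2⟩ := x
      obtain ⟨y1, y2⟩ := y
      obtain rfl : x1 = y1 := h4
      have hk := fun hm => (h5 k hm).2 _ hadj
      have hl := fun hm => (h5 l hm).2 _ hadj.symm
      have hx := fun h6 h7 => (hbetween x2 h6 h7).2 _ h1
      have hy := fun h6 h7 => (hbetween y2 h6 h7).2 _ h1.symm
      simp only [Prod.mk.injEq, true_and] at h2 h3 hm hk hl hx hy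
      grind
    · exact ⟨hwD, .inl hE''⟩
    · exact ⟨hwD, .inr ⟨rfl, by grind⟩⟩
    · exact ⟨hkD, .inl hE'⟩
    · exact ⟨hlD, .inr ⟨rfl, by grind⟩⟩

theorem IsK4Subdiv.exists_fill_list {E : Fin 3 × ℕ → Fin 3 × ℕ → Prop}
    {S : SimpleGraph (Fin 3 × ℕ)} (h : IsK4Subdiv S) (D : Finset (Fin 3 × ℕ))
    (hE : ∀ x y, E x y → E y x)
    (hcol : ∀ i m, (i, m) ∈ D → (i, m + 1) ∈ D → E (i, m) (i, m + 1))
    (T : List (Fin 3 × ℕ)) (edges : List ((Fin 3 × ℕ) × (Fin 3 × ℕ)))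
    (hT : ∀ x y, S.Adj x y → x ∈ T)
    (hS : ∀ x y, S.Adj x y → (x, y) ∈ edges ∨ (y, x) ∈ edges)
    (hgood : ∀ e ∈ edges, e.1 ∈ D ∧ e.2 ∈ D ∧ (E e.1 e.2 ∨ (e.1.1 = e.2.1 ∧ ∀ m,
      (e.1.2 < m ∧ m < e.2.2 ∨ e.2.2 < m ∧ m < e.1.2) → (e.1.1, m) ∈ D ∧ (e.1.1, m) ∉ T))) :
    ∃ S' : SimpleGraph (Fin 3 × ℕ), IsK4Subdiv S' ∧ ∀ x y, S'.Adj x y → x ∈ D ∧ E x y := by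
  have hiso : ∀ w, w ∉ T → ∀ z, ¬ S.Adj w z := fun w hw z hz => hw (hT w z hz)
  refine h.exists_fill D hE hcol fun x y hxy => ?_
  rcases hS x y hxy with h1 | h1
  · obtain ⟨hx, -, he | ⟨heq, hm⟩⟩ := hgood _ h1
    · exact ⟨hx, .inl he⟩
    · exact ⟨hx, .inr ⟨heq, fun m hm' => (hm m hm').imp_right (hiso _)⟩⟩
  · obtain ⟨-, hx, he | ⟨heq, hm⟩⟩ := hgood _ h1
    · exact ⟨hx, .inl (hE _ _ he)⟩
    · refine ⟨hx, .inr ⟨heq.symm, fun m hm' => ?_⟩⟩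
      dsimp only at heq hm
      rw [← heq]
      exact (hm m hm'.symm).imp_right (hiso _)

/-- Adjacency in the prism whose rungs are paths of lengths `L 0`, `L 1`, `L 2`; the vertex at
height `m` on rung `i` is `(i, m)`. -/
def LadderAdj (L : Fin 3 → ℕ) (x y : Fin 3 × ℕ) : Prop :=
  (x.1 = y.1 ∧ (x.2 + 1 = y.2 ∨ y.2 + 1 = x.2)) ∨
    (x.1 ≠ y.1 ∧ ((x.2 = 0 ∧ y.2 = 0) ∨ (x.2 = L x.1 ∧ y.2 = L y.1)))

theorem LadderAdj.symm {L : Fin 3 → ℕ} {x y : Fin 3 × ℕ} (h : LadderAdj L x y) :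
    LadderAdj L y x := by
  unfold LadderAdj at *
  grind

/-- The vertices of the prism with rung lengths `L`. -/
def ladderVerts (L : Fin 3 → ℕ) : Finset (Fin 3 × ℕ) :=
  (Finset.univ ×ˢ Finset.range (∑ i, L i + 1)).filter fun x => x.2 ≤ L x.1

theorem mem_ladderVerts {L : Fin 3 → ℕ} {x : Fin 3 × ℕ} :
    x ∈ ladderVerts L ↔ x.2 ≤ L x.1 := by
  have := Finset.single_le_sum (f := L) (fun _ _ => Nat.zero_le _) (Finset.mem_univ x.1)
  simp only [ladderVerts, Finset.mem_filter, Finset.mem_product, Finset.mem_univ,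
    Finset.mem_range, true_and]
  omega

/-- The prism minus a triangle edge contains a `K₄`-subdivision. -/
theorem exists_isK4Subdiv_avoiding_edge {L s t : Fin 3 → ℕ} (hL : ∀ i, 0 < L i)
    (hst : (s = 0 ∧ t = L) ∨ (s = L ∧ t = 0)) {j k : Fin 3} (hjk : j ≠ k) :
    ∃ S : SimpleGraph (Fin 3 × ℕ), IsK4Subdiv S ∧ ∀ x y, S.Adj x y → x ∈ ladderVerts L ∧
      LadderAdj L x y ∧ ¬(x = (j, t j) ∧ y = (k, t k)) ∧ ¬(x = (k, t k) ∧ y = (j, t j)) := by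
  obtain ⟨i, hij, hik⟩ : ∃ i : Fin 3, i ≠ j ∧ i ≠ k := by
    revert j k; decide
  have hLi := hL i
  have hLj := hL j
  have hLk := hL k
  have hends : (s i = 0 ∧ s j = 0 ∧ s k = 0 ∧ t i = L i ∧ t j = L j ∧ t k = L k) ∨
      (t i = 0 ∧ t j = 0 ∧ t k = 0 ∧ s i = L i ∧ s j = L j ∧ s k = L k) := by
    rcases hst with ⟨rfl, rfl⟩ | ⟨rfl, rfl⟩ <;> simp
  obtain ⟨S₀, h₀, hS₀⟩ := IsK4Subdiv.exists_complete (a := (i, s i)) (b := (j, s j))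
    (c := (k, s k)) (d := (i, t i)) (by grind) (by grind) (by grind) (by grind) (by grind)
    (by grind)
  obtain ⟨S₁, h₁, hS₁⟩ := h₀.exists_subdivide (x := (i, t i)) (y := (j, s j)) (w := (j, t j))
    (by grind) (by grind)
  obtain ⟨S₂, h₂, hS₂⟩ := h₁.exists_subdivide (x := (i, t i)) (y := (k, s k)) (w := (k, t k))
    (by grind) (by grind)
  refine h₂.exists_fill_list (ladderVerts L) (by grind [LadderAdj.symm])
    (by grind [LadderAdj])
    [(i, s i), (j, s j), (k, s k), (i, t i), (j, t j), (k, t k)]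
    [((i, s i), (j, s j)), ((i, s i), (k, s k)), ((j, s j), (k, s k)), ((i, s i), (i, t i)),
      ((j, s j), (j, t j)), ((k, s k), (k, t k)), ((i, t i), (j, t j)), ((i, t i), (k, t k))]
    (by grind) (by grind) ?_
  clear hS₀ hS₁ hS₂ h₀ h₁ h₂ hst
  simp only [List.mem_cons, List.not_mem_nil, or_false, mem_ladderVerts, LadderAdj,
    Prod.mk.injEq]
  rintro e (rfl | rfl | rfl | rfl | rfl | rfl | rfl | rfl) <;>
    refine ⟨by grind, by grind, ?_⟩ <;>
    first
    | exact .inl (by grind)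
    | exact .inr ⟨rfl, by grind⟩

/-- Shortcutting a segment of a rung frees a vertex inside that segment. -/
theorem exists_isK4Subdiv_of_shortcut {L : Fin 3 → ℕ} (hL : ∀ i, 0 < L i) {i : Fin 3} {p q : ℕ}
    (hpq : p + 1 < q) (hq : q ≤ L i) :
    ∃ S : SimpleGraph (Fin 3 × ℕ), IsK4Subdiv S ∧ ∀ x y, S.Adj x y →
      x ∈ (ladderVerts L).erase (i, p + 1) ∧
      (LadderAdj L x y ∨ (x = (i, p) ∧ y = (i, q)) ∨ (x = (i, q) ∧ y = (i, p))) := by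
  obtain ⟨j, k, hij, hik, hjk⟩ : ∃ j k : Fin 3, i ≠ j ∧ i ≠ k ∧ j ≠ k := by
    clear hq; revert i; decide
  have hLi := hL i
  have hLj := hL j
  have hLk := hL k
  obtain ⟨S₀, h₀, hS₀⟩ := IsK4Subdiv.exists_complete (a := (i, 0)) (b := (j, 0))
    (c := (k, 0)) (d := (i, L i)) (by grind) (by grind) (by grind) (by grind) (by grind)
    (by grind)
  obtain ⟨S₁, h₁, hS₁⟩ := h₀.exists_subdivide (x := (i, L i)) (y := (j, 0)) (w := (j, L j))
    (by grind) (by grind)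
  obtain ⟨S₂, h₂, hS₂⟩ := h₁.exists_subdivide (x := (i, L i)) (y := (k, 0)) (w := (k, L k))
    (by grind) (by grind)
  obtain ⟨S₃, h₃, hS₃⟩ := h₂.exists_subdivide_or_eq (x := (i, 0)) (y := (i, L i)) (w := (i, p))
    (by grind) (by grind)
  obtain ⟨S₄, h₄, hS₄⟩ := h₃.exists_subdivide_or_eq (x := (i, p)) (y := (i, L i)) (w := (i, q))
    (by grind) (by grind)
  refine h₄.exists_fill_list ((ladderVerts L).erase (i, p + 1)) (by grind [LadderAdj.symm])
    (by grind [LadderAdj])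
    [(i, 0), (j, 0), (k, 0), (i, L i), (j, L j), (k, L k), (i, p), (i, q)]
    [((i, 0), (j, 0)), ((i, 0), (k, 0)), ((j, 0), (k, 0)), ((i, 0), (i, p)),
      ((i, p), (i, q)), ((i, q), (i, L i)),
      ((j, 0), (j, L j)), ((k, 0), (k, L k)), ((i, L i), (j, L j)), ((i, L i), (k, L k))]
    (by grind) (by grind (splits := 40) (gen := 20) (ematch := 20)) ?_
  clear hS₀ hS₁ hS₂ hS₃ hS₄ h₀ h₁ h₂ h₃ h₄
  simp only [List.mem_cons, List.not_mem_nil, or_false, mem_ladderVerts, LadderAdj,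
    Prod.mk.injEq, Finset.mem_erase, ne_eq]
  rintro e (rfl | rfl | rfl | rfl | rfl | rfl | rfl | rfl | rfl | rfl) <;>
    refine ⟨by grind, by grind, ?_⟩ <;>
    first
    | exact .inl (by grind)
    | exact .inr ⟨rfl, by grind⟩

/-- An edge joining two rungs creates a `K₄`-subdivision missing an end of a rung. -/
theorem exists_isK4Subdiv_of_cross {L : Fin 3 → ℕ} (hL : ∀ i, 0 < L i) {i j : Fin 3}
    (hij : i ≠ j) {p q : ℕ} (hp : p < L i) (hq0 : 0 < q) (hq : q ≤ L j) :
    ∃ S : SimpleGraph (Fin 3 × ℕ), IsK4Subdiv S ∧ ∀ x y, S.Adj x y →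
      x ∈ (ladderVerts L).erase (j, 0) ∧
      (LadderAdj L x y ∨ (x = (i, p) ∧ y = (j, q)) ∨ (x = (j, q) ∧ y = (i, p))) := by
  obtain ⟨k, hik, hjk⟩ : ∃ k : Fin 3, i ≠ k ∧ j ≠ k := by
    clear hp hq; revert i j; decide
  have hLi := hL i
  have hLj := hL j
  have hLk := hL k
  obtain ⟨S₀, h₀, hS₀⟩ := IsK4Subdiv.exists_complete (a := (i, p)) (b := (i, L i))
    (c := (j, L j)) (d := (k, L k)) (by grind) (by grind) (by grind) (by grind) (by grind)
    (by grind)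
  obtain ⟨S₁, h₁, hS₁⟩ := h₀.exists_subdivide_or_eq (x := (i, p)) (y := (j, L j)) (w := (j, q))
    (by grind) (by grind)
  obtain ⟨S₂, h₂, hS₂⟩ := h₁.exists_subdivide (x := (i, p)) (y := (k, L k)) (w := (k, 0))
    (by grind) (by grind)
  obtain ⟨S₃, h₃, hS₃⟩ := h₂.exists_subdivide_or_eq (x := (i, p)) (y := (k, 0)) (w := (i, 0))
    (by grind) (by grind)
  refine h₃.exists_fill_list ((ladderVerts L).erase (j, 0)) (by grind [LadderAdj.symm])
    (by grind [LadderAdj])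
    [(i, p), (i, L i), (j, L j), (k, L k), (j, q), (k, 0), (i, 0)]
    [((i, p), (i, L i)), ((i, L i), (j, L j)), ((i, L i), (k, L k)), ((j, L j), (k, L k)),
      ((i, p), (j, q)), ((j, q), (j, L j)), ((i, p), (i, 0)), ((i, 0), (k, 0)),
      ((k, 0), (k, L k))]
    (by grind) (by grind (splits := 40) (gen := 20) (ematch := 20)) ?_
  clear hS₀ hS₁ hS₂ hS₃ h₀ h₁ h₂ h₃
  simp only [List.mem_cons, List.not_mem_nil, or_false, mem_ladderVerts, LadderAdj,
    Prod.mk.injEq, Finset.mem_erase, ne_eq]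
  rintro e (rfl | rfl | rfl | rfl | rfl | rfl | rfl | rfl | rfl) <;>
    refine ⟨by grind, by grind, ?_⟩ <;>
    first
    | exact .inl (by grind)
    | exact .inr ⟨rfl, by grind⟩

/-- `f` identifies `H` with the prism with rung lengths `L`. -/
structure IsLadder {V : Type*} (H : SimpleGraph V) (L : Fin 3 → ℕ) (f : V → Fin 3 × ℕ) :
    Prop where
  pos : ∀ i, 0 < L i
  inj : Function.Injective f
  range : ∀ x, (∃ a, f a = x) ↔ x ∈ ladderVerts L
  adj : ∀ a b, H.Adj a b ↔ LadderAdj L (f a) (f b)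

/-- A `K₄`-subdivision missing a vertex, or else a prism whose triangles are not subdivided. -/
def PrismInvariant {V : Type*} (H : SimpleGraph V) : Prop :=
  (∃ (S : SimpleGraph V) (v : V), IsK4Subdiv S ∧ S ≤ H ∧ ∀ z, ¬ S.Adj v z) ∨
    ∃ L f, IsLadder H L f

theorem PrismInvariant.iso {V W : Type*} {H : SimpleGraph V} {K : SimpleGraph W}
    (h : PrismInvariant K) (e : H ≃g K) : PrismInvariant H := by
  rcases h with ⟨S, v, hS, hle, hv⟩ | ⟨L, f, hf⟩
  · refine .inl ⟨S.comap e, e.symm v, hS.comap e.injective fun x _ _ => e.surjective x, ?_, ?_⟩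
    · intro a b hab
      exact e.map_adj_iff.1 (hle hab)
    · intro z hz
      rw [comap_adj, e.apply_symm_apply] at hz
      exact hv _ hz
  · refine .inr ⟨L, f ∘ e, hf.pos, hf.inj.comp e.injective, fun x => ?_, fun a b => ?_⟩
    · rw [← hf.range, e.surjective.exists]
      rfl
    · rw [← e.map_adj_iff, hf.adj]
      rfl

theorem prismInvariant_prism : PrismInvariant prism := by
  refine .inr ⟨fun _ => 1, fun x => (x.1, x.2.val), fun _ => one_pos, ?_, ?_, ?_⟩
  · rintro ⟨a, b⟩ ⟨c, d⟩ h
    simp only [Prod.mk.injEq, Fin.val_inj] at h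
    exact Prod.ext h.1 h.2
  · rintro ⟨i, m⟩
    rw [mem_ladderVerts]
    constructor
    · rintro ⟨⟨a, b⟩, h⟩
      simp only [Prod.mk.injEq] at h
      omega
    · intro h
      exact ⟨(i, ⟨m, by dsimp only at h; omega⟩), rfl⟩
  · rintro ⟨a, b⟩ ⟨c, d⟩
    simp only [prism, boxProd_adj, top_adj, LadderAdj]
    revert a b c d
    decide

theorem PrismInvariant.subdivideEdge_of_avoids {n : ℕ} {H S : SimpleGraph (Fin n)} {u v : Fin n}
    (hS : IsK4Subdiv S) (hle : S ≤ H) (huv : ¬ S.Adj u v) :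
    PrismInvariant (subdivideEdge H u v) := by
  refine .inl ⟨S.map Fin.castSuccEmb, Fin.last n, hS.map _, ?_, ?_⟩
  · rintro _ _ ⟨-, a, b, hab, rfl, rfl⟩
    refine (subdivideEdge_adj_castSucc H u v a b).2 ⟨hle hab, ?_, ?_⟩
    · rintro ⟨rfl, rfl⟩
      exact huv hab
    · rintro ⟨rfl, rfl⟩
      exact huv hab.symm
  · rintro z ⟨-, a, b, -, ha, -⟩
    exact Fin.castSucc_ne_last a ha

theorem subdivideEdge_comm {n : ℕ} (H : SimpleGraph (Fin n)) (u v : Fin n) :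
    subdivideEdge H u v = subdivideEdge H v u := by
  ext a b
  simp only [subdivideEdge_adj]
  grind

/-- Subdividing a rung edge makes that rung longer by one. -/
theorem IsLadder.subdivideEdge {n : ℕ} {H : SimpleGraph (Fin n)} {L : Fin 3 → ℕ}
    {f : Fin n → Fin 3 × ℕ} (hf : IsLadder H L f) {u v : Fin n} {i : Fin 3} {m : ℕ}
    (hu : f u = (i, m)) (hv : f v = (i, m + 1)) :
    IsLadder (subdivideEdge H u v) (Function.update L i (L i + 1))
      (Fin.snoc (fun a => if (f a).1 = i ∧ m < (f a).2 then ((f a).1, (f a).2 + 1) else f a)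
        (i, m + 1)) := by
  have hpos := hf.pos
  have hinj := hf.inj
  have hmL : m + 1 ≤ L i := by
    have := mem_ladderVerts.1 ((hf.range (f v)).1 ⟨v, rfl⟩)
    rwa [hv] at this
  have hmem : ∀ a, (f a).2 ≤ L (f a).1 := fun a => mem_ladderVerts.1 ((hf.range (f a)).1 ⟨a, rfl⟩)
  have hfu : ∀ a, a = u ↔ f a = (i, m) := fun a => by rw [← hu, hinj.eq_iff]
  have hfv : ∀ a, a = v ↔ f a = (i, m + 1) := fun a => by rw [← hv, hinj.eq_iff]
  refine ⟨fun j => ?_, ?_, ?_, ?_⟩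
  · grind
  · rw [Fin.snoc_injective_iff]
    refine ⟨fun a b hab => hinj ?_, ?_⟩
    · dsimp only at hab
      grind
    · rintro ⟨a, ha⟩
      dsimp only at ha
      grind
  · rintro ⟨c, r⟩
    rw [Fin.exists_fin_succ', mem_ladderVerts]
    simp only [Fin.snoc_castSucc, Fin.snoc_last]
    constructor
    · rintro (⟨a, ha⟩ | h)
      · have := hmem a
        grind
      · grind
    · intro hr
      by_cases h1 : c = i ∧ m + 1 = r
      · exact .inr (by grind)
      · obtain ⟨a, ha⟩ := (hf.range (c, if c = i ∧ m < r then r - 1 else r)).2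
          (mem_ladderVerts.2 (by grind))
        exact .inl ⟨a, by grind⟩
  · have hlast : ∀ b, (b = u ∨ b = v) ↔ LadderAdj (Function.update L i (L i + 1)) (i, m + 1)
        (if (f b).1 = i ∧ m < (f b).2 then ((f b).1, (f b).2 + 1) else f b) := by
      intro b
      rw [hfu, hfv]
      have := hmem b
      obtain ⟨c, r⟩ := f b
      simp only [LadderAdj, Function.update_apply]
      grind
    intro a b
    induction a using Fin.lastCases with
    | last =>
      rw [subdivideEdge_adj_last_left]
      induction b using Fin.lastCases with
      | last => simp [LadderAdj, (Fin.castSucc_ne_last _).symm]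
      | cast b => simpa using hlast b
    | cast a =>
      induction b using Fin.lastCases with
      | last =>
        rw [adj_comm, subdivideEdge_adj_last_left]
        simp only [Fin.snoc_castSucc, Fin.snoc_last, Fin.castSucc_inj]
        exact (hlast a).trans ⟨LadderAdj.symm, LadderAdj.symm⟩
      | cast b =>
        rw [subdivideEdge_adj_castSucc, hf.adj]
        simp only [Fin.snoc_castSucc, hfu, hfv]
        have ha := hmem a
        have hb := hmem b
        have hposa := hpos (f a).1
        have hposb := hpos (f b).1
        obtain ⟨c, r⟩ := f a
        obtain ⟨d, t⟩ := f b
        simp only [LadderAdj, Function.update_apply, Prod.mk.injEq]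
        grind

theorem PrismInvariant.subdivideEdge {n : ℕ} {H : SimpleGraph (Fin n)} (h : PrismInvariant H)
    {u v : Fin n} (huv : H.Adj u v) : PrismInvariant (subdivideEdge H u v) := by
  rcases h with ⟨S, w, hS, hle, hw⟩ | ⟨L, f, hf⟩
  · by_cases hSuv : S.Adj u v
    · have hlast : ∀ z, ¬ (S.map Fin.castSuccEmb).Adj (Fin.last n) z := by
        rintro z ⟨-, a, b, -, ha, -⟩
        exact Fin.castSucc_ne_last a ha
      obtain ⟨S', hS', h'⟩ := (hS.map Fin.castSuccEmb).exists_subdivide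
        ⟨(Fin.castSucc_injective n).ne hSuv.ne, u, v, hSuv, rfl, rfl⟩ hlast
      simp only [Fin.coe_castSuccEmb] at h'
      refine .inl ⟨S', w.castSucc, hS', ?_, ?_⟩
      · intro a b hab
        rw [subdivideEdge_adj]
        rcases (h' a b).1 hab with ⟨⟨-, a, b, hS, rfl, rfl⟩, h1, h2⟩ | h | h
        · refine .inl ⟨a, b, rfl, rfl, hle hS, ?_, ?_⟩
          · rintro ⟨rfl, rfl⟩
            exact h1 ⟨rfl, rfl⟩
          · rintro ⟨rfl, rfl⟩
            exact h2 ⟨rfl, rfl⟩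
        · exact .inr (.inl h)
        · exact .inr (.inr h)
      · intro z hz
        have hwu : w ≠ u := fun e => hw v (e ▸ hSuv)
        have hwv : w ≠ v := fun e => hw u (e ▸ hSuv.symm)
        rcases (h' _ _).1 hz with ⟨⟨-, a, b, hab, ha, -⟩, -⟩ | ⟨h, -⟩ | ⟨-, h | h⟩
        · exact hw b (Fin.castSucc_injective n ha ▸ hab)
        · exact Fin.castSucc_ne_last w h
        · exact hwu (Fin.castSucc_injective n h)
        · exact hwv (Fin.castSucc_injective n h)
    · exact .subdivideEdge_of_avoids hS hle hSuv
  · have hadj := (hf.adj u v).1 huv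
    obtain ⟨⟨i, p⟩, hfu⟩ : ∃ x, f u = x := ⟨_, rfl⟩
    obtain ⟨⟨j, q⟩, hfv⟩ : ∃ x, f v = x := ⟨_, rfl⟩
    rw [hfu, hfv] at hadj
    rcases hadj with ⟨h1, h2 | h2⟩ | ⟨h1, h2⟩
    · dsimp only at h1 h2
      subst h1 h2
      exact .inr ⟨_, _, hf.subdivideEdge hfu hfv⟩
    · dsimp only at h1 h2
      subst h1 h2
      rw [subdivideEdge_comm]
      exact .inr ⟨_, _, hf.subdivideEdge hfv hfu⟩
    · obtain ⟨s, t, hst, ht⟩ : ∃ s t : Fin 3 → ℕ, ((s = 0 ∧ t = L) ∨ (s = L ∧ t = 0)) ∧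
          p = t i ∧ q = t j := by
        rcases h2 with h2 | h2
        · exact ⟨L, 0, .inr ⟨rfl, rfl⟩, h2⟩
        · exact ⟨0, L, .inl ⟨rfl, rfl⟩, h2⟩
      obtain ⟨S, hS, h⟩ := exists_isK4Subdiv_avoiding_edge hf.pos hst h1
      refine .subdivideEdge_of_avoids (S := S.comap f)
        (hS.comap hf.inj fun x y hxy => (hf.range x).2 (h x y hxy).1)
        (fun a b hab => (hf.adj a b).2 (h _ _ hab).2.1) fun hab => ?_
      refine (h _ _ hab).2.2.1 ⟨?_, ?_⟩
      · rw [hfu, ht.1]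
      · rw [hfv, ht.2]

/-- A `K₄`-subdivision in the coordinates of a ladder yields one in the graph itself. -/
theorem IsLadder.hasProperK4Subdivision {V : Type*} {H G : SimpleGraph V} {L : Fin 3 → ℕ}
    {f : V → Fin 3 × ℕ} (hf : IsLadder H L f) {S : SimpleGraph (Fin 3 × ℕ)} (hS : IsK4Subdiv S)
    {w : Fin 3 × ℕ} (hw : w ∈ ladderVerts L)
    (hD : ∀ x y, S.Adj x y → x ∈ (ladderVerts L).erase w)
    (hG : ∀ a b, S.Adj (f a) (f b) → G.Adj a b) : HasProperK4Subdivision G := by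
  obtain ⟨a, rfl⟩ := (hf.range w).2 hw
  refine IsK4Subdiv.hasProperK4Subdivision (S := S.comap f) (v := a) ?_ (fun a b => hG a b) ?_
  · exact hS.comap hf.inj fun x y hxy => (hf.range x).2 (Finset.mem_of_mem_erase (hD x y hxy))
  · intro z hz
    exact Finset.ne_of_mem_erase (hD _ _ hz) rfl

theorem IsLadder.hasProperK4Subdivision_of_adj {V : Type*} {H G : SimpleGraph V} {L : Fin 3 → ℕ}
    {f : V → Fin 3 × ℕ} (hf : IsLadder H L f) (hle : H ≤ G) {u v : V} (huv : G.Adj u v)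
    (hnadj : ¬ H.Adj u v) : HasProperK4Subdivision G := by
  have hvu := huv.symm
  have hne : f u ≠ f v := fun e => huv.ne (hf.inj e)
  have hu := mem_ladderVerts.1 ((hf.range (f u)).1 ⟨u, rfl⟩)
  have hv := mem_ladderVerts.1 ((hf.range (f v)).1 ⟨v, rfl⟩)
  rw [hf.adj] at hnadj
  have hG : ∀ a b, (LadderAdj L (f a) (f b) ∨ (f a = f u ∧ f b = f v) ∨
      (f a = f v ∧ f b = f u)) → G.Adj a b := by
    rintro a b (h | ⟨h1, h2⟩ | ⟨h1, h2⟩)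
    · exact hle ((hf.adj a b).2 h)
    · rwa [hf.inj h1, hf.inj h2]
    · rwa [hf.inj h1, hf.inj h2]
  obtain ⟨⟨i, p⟩, hfu⟩ : ∃ x, f u = x := ⟨_, rfl⟩
  obtain ⟨⟨j, q⟩, hfv⟩ : ∃ x, f v = x := ⟨_, rfl⟩
  simp only [hfu, hfv] at hne hu hv hnadj hG
  have hpos := hf.pos
  have hpi := hpos i
  have hpj := hpos j
  simp only [LadderAdj] at hnadj
  by_cases hij : i = j
  · subst hij
    rcases lt_or_gt_of_ne (show p ≠ q by grind) with hpq | hpq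
    · obtain ⟨S, hS, h⟩ := exists_isK4Subdiv_of_shortcut hpos (p := p) (by grind) hv
      exact hf.hasProperK4Subdivision hS (mem_ladderVerts.2 (by grind))
        (fun x y hxy => (h x y hxy).1) fun a b hab => hG a b (h _ _ hab).2
    · obtain ⟨S, hS, h⟩ := exists_isK4Subdiv_of_shortcut hpos (p := q) (by grind) hu
      exact hf.hasProperK4Subdivision hS (mem_ladderVerts.2 (by grind))
        (fun x y hxy => (h x y hxy).1) fun a b hab => hG a b ((h _ _ hab).2.imp_right Or.symm)
  · by_cases hc : p < L i ∧ 0 < q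
    · obtain ⟨S, hS, h⟩ := exists_isK4Subdiv_of_cross hpos hij hc.1 hc.2 hv
      exact hf.hasProperK4Subdivision hS (mem_ladderVerts.2 (by grind))
        (fun x y hxy => (h x y hxy).1) fun a b hab => hG a b (h _ _ hab).2
    · obtain ⟨S, hS, h⟩ := exists_isK4Subdiv_of_cross hpos (Ne.symm hij) (p := q) (q := p)
        (by grind) (by grind) hu
      exact hf.hasProperK4Subdivision hS (mem_ladderVerts.2 (by grind))
        (fun x y hxy => (h x y hxy).1) fun a b hab => hG a b ((h _ _ hab).2.imp_right Or.symm)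

theorem IsSubdivision.prismInvariant {V : Type*} {H : SimpleGraph V}
    (h : IsSubdivision H prism) : PrismInvariant H := by
  obtain ⟨A, B, ⟨eA⟩, ⟨eB⟩, hAB⟩ := h
  refine PrismInvariant.iso ?_ eA
  clear eA
  induction hAB using Relation.ReflTransGen.head_induction_on with
  | refl => exact prismInvariant_prism.iso eB.symm
  | head hstep _ ih =>
    obtain ⟨G, u, v, huv⟩ := hstep
    exact ih.subdivideEdge huv

/-- Adding an edge to a subdivision of the prism creates a proper `K₄`-subdivision. -/
theorem prism_subdivision_plus_edge {α : Type*} (G H : SimpleGraph α) (u v : α)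
    (hsub : IsSubdivision H prism) (hne : u ≠ v) (hnadj : ¬ H.Adj u v)
    (hG : G = H ⊔ SimpleGraph.fromEdgeSet {s(u, v)}) :
    HasProperK4Subdivision G := by
  have hle : H ≤ G := hG ▸ le_sup_left
  rcases hsub.prismInvariant with ⟨S, w, hS, hSH, hw⟩ | ⟨L, f, hf⟩
  · exact hS.hasProperK4Subdivision (hSH.trans hle) hw
  · have huv : G.Adj u v := by simp [hG, hne]
    exact hf.hasProperK4Subdivision_of_adj hle huv hnadj

end IMWQO
end
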